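/- arXiv:2309.00467 — 2 statements merged into one kernel-verified Lean document; each statement's English description precedes it below -/
import Mathlib

section
/- Kirillov's conjecture holds for permutations with separated descents: if u,v ∈ S_n have separated descents (at some position k), then for every permutation w the polynomial ∂_{w/v} 𝔖_u(x) has nonnegative integer coefficients, i.e. ∂_{w/v}𝔖_u(x) ∈ ℤ_{≥0}[x_1,x_2,…]. -/
open MvPolynomial

noncomputable section

namespace BPDPuzzle

/-- `x ⊖ y = (x - y)/(1 + β·y)`. -/
def ominus {K : Type*} [Field K] (β a b : K) : K := (a - b) / (1 + β * b)

/-- A permutation of `ℕ` lying in `S_∞`, i.e. fixing all sufficiently large integers. -/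
def FinPerm (w : Equiv.Perm ℕ) : Prop := ∃ N : ℕ, ∀ j, N ≤ j → w j = j

/-- A permutation of `ℕ` lying in `S_n` (0-based positions `0, …, n-1`). -/
def InSn (n : ℕ) (w : Equiv.Perm ℕ) : Prop := ∀ j, n ≤ j → w j = j

/-- Coxeter length: the number of inversions. -/
def len (w : Equiv.Perm ℕ) : ℕ := Set.ncard {p : ℕ × ℕ | p.1 < p.2 ∧ w p.2 < w p.1}

/-- The simple transposition `s_i`, exchanging the (0-based) positions `i` and `i+1`. -/
def sTr (i : ℕ) : Equiv.Perm ℕ := Equiv.swap i (i + 1)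

/-- `u` and `v` have separated descents at position `k`, i.e.
`maxdes(u) ≤ k ≤ mindes(v)` (in 0-based conventions: `u` has no descent at any
0-based position `≥ k` and `v` has no descent at any 0-based position `< k-1`). -/
def SepDesc (k : ℕ) (u v : Equiv.Perm ℕ) : Prop :=
  (∀ i, k ≤ i → u i ≤ u (i + 1)) ∧ (∀ i, i + 1 < k → v i ≤ v (i + 1))

/-- The longest element `n ⋯ 2 1` of `S_n`, extended by the identity. -/
def revPerm (n : ℕ) : Equiv.Perm ℕ where
  toFun j := if j < n then n - 1 - j else j
  invFun j := if j < n then n - 1 - j else j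
  left_inv j := by dsimp only; split_ifs <;> omega
  right_inv j := by dsimp only; split_ifs <;> omega

/-- Exchange the values of a valuation at the indices `i` and `i+1`. -/
def swapVal {K : Type*} (t : ℕ → K) (i : ℕ) : ℕ → K :=
  fun j => if j = i then t (i + 1) else if j = i + 1 then t i else t j

/-- The defining properties of the family of double Grothendieck polynomials
`𝔊_w(x, t)`, viewed as a family of polynomials in the `x`-variables depending on
a valuation `t` of the second set of variables:  the initial condition
`𝔊_{n⋯21}(x,t) = ∏_{i+j≤n} (x_i ⊖ t_j)` together with the Demazure recursion
`π_i 𝔊_w = 𝔊_{w s_i}` whenever `w(i) > w(i+1)` (the latter written with the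
denominator `x_i - x_{i+1}` cleared). -/
def GrothFamily {K : Type*} [Field K] (β : K)
    (G : (ℕ → K) → Equiv.Perm ℕ → MvPolynomial ℕ K) : Prop :=
  ∀ t : ℕ → K, (∀ j, 1 + β * t j ≠ 0) →
    (∀ n : ℕ, G t (revPerm n) =
      ∏ i ∈ Finset.range n, ∏ j ∈ Finset.range (n - 1 - i),
        C ((1 + β * t j)⁻¹) * (X i - C (t j))) ∧
    (∀ (w : Equiv.Perm ℕ) (i : ℕ), w (i + 1) < w i →
      (X i - X (i + 1)) * G t (w * sTr i) =
        (1 + C β * X (i + 1)) * G t w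
          - (1 + C β * X i) * rename ⇑(Equiv.swap i (i + 1)) (G t w))

/-- The defining property of the structure constants `c_{u,v}^w(t,y)`:
`𝔊_u(x,y) · 𝔊_v(x,t) = Σ_w c_{u,v}^w(t,y) · 𝔊_w(x,t)`, the (finitely supported)
sum ranging over the permutations `w ∈ S_∞`. -/
def StructConsts {K : Type*} [Field K] (β : K)
    (G : (ℕ → K) → Equiv.Perm ℕ → MvPolynomial ℕ K)
    (c : (ℕ → K) → (ℕ → K) → Equiv.Perm ℕ → Equiv.Perm ℕ → Equiv.Perm ℕ → K) : Prop :=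
  ∀ t y : ℕ → K, (∀ j, 1 + β * t j ≠ 0) → (∀ j, 1 + β * y j ≠ 0) →
    ∀ u v : Equiv.Perm ℕ, FinPerm u → FinPerm v →
      {w : Equiv.Perm ℕ | c t y u v w ≠ 0}.Finite ∧
      (∀ w, ¬ FinPerm w → c t y u v w = 0) ∧
      G y u * G t v = ∑ᶠ w : Equiv.Perm ℕ, C (c t y u v w) * G t w

/-! ### The lattice model / pipe puzzles -/

/-- A state of the `n × n` lattice model: labels in `{0, …, n}` on all horizontal
and vertical (half-)edges.  `sst.1 i j` is the `j`-th horizontal (half-)edge of row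
`i` (`j = 0` being the left boundary and `j = n` the right boundary), and
`sst.2 i j` is the `i`-th vertical (half-)edge of column `j` (`i = 0` the top
boundary, `i = n` the bottom boundary). -/
abbrev GridState (n : ℕ) : Type :=
  (Fin n → Fin (n + 1) → Fin (n + 1)) × (Fin (n + 1) → Fin n → Fin (n + 1))

/-- The label on the north edge of the tile in row `i`, column `j`. -/
def labN {n : ℕ} (sst : GridState n) (i j : Fin n) : ℕ := (sst.2 i.castSucc j : ℕ)
/-- The label on the east edge of the tile in row `i`, column `j`. -/
def labE {n : ℕ} (sst : GridState n) (i j : Fin n) : ℕ := (sst.1 i j.succ : ℕ)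
/-- The label on the west edge of the tile in row `i`, column `j`. -/
def labW {n : ℕ} (sst : GridState n) (i j : Fin n) : ℕ := (sst.1 i j.castSucc : ℕ)
/-- The label on the south edge of the tile in row `i`, column `j`. -/
def labS {n : ℕ} (sst : GridState n) (i j : Fin n) : ℕ := (sst.2 i.succ j : ℕ)

/-- Boundary label `κ_u` on the right side (0-based row `i`, 1-based pipe labels). -/
def kappaLab (k : ℕ) (u : Equiv.Perm ℕ) (i : ℕ) : ℕ :=
  if u⁻¹ i < k then u⁻¹ i + 1 else 0

/-- Boundary label `θ_v` on the top side (0-based column `j`, 1-based pipe labels). -/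
def thetaLab (k : ℕ) (v : Equiv.Perm ℕ) (j : ℕ) : ℕ :=
  if k ≤ v⁻¹ j then v⁻¹ j + 1 else 0

/-- Boundary label `η_w` on the bottom side (0-based column `j`, 1-based pipe labels). -/
def etaLab (w : Equiv.Perm ℕ) (j : ℕ) : ℕ := w⁻¹ j + 1

/-- The boundary condition for pipe puzzles for `(u, v, w)`: left edges all `0`,
right edges `κ_u`, top edges `θ_v`, bottom edges `η_w`. -/
def BoundaryCond (n k : ℕ) (u v w : Equiv.Perm ℕ) (sst : GridState n) : Prop :=
  (∀ i : Fin n, (sst.1 i 0 : ℕ) = 0) ∧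
  (∀ i : Fin n, (sst.1 i (Fin.last n) : ℕ) = kappaLab k u (i : ℕ)) ∧
  (∀ j : Fin n, (sst.2 0 j : ℕ) = thetaLab k v (j : ℕ)) ∧
  (∀ j : Fin n, (sst.2 (Fin.last n) j : ℕ) = etaLab w (j : ℕ))

/-- The admissible local configurations (tiles) of a pipe puzzle, in terms of the
four edge labels `N, E, W, S` around a tile:  the empty tile, the vertical pipe,
the horizontal pipe, the crossing (with the horizontal pipe carrying the smaller
label), the two elbows `⌟` and `⌐` (labels `≤ k` coming from the right side,
labels `> k` from the top side), and the bumping tiles (with the stated label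
restrictions). -/
def LAdm (k N E W S : ℕ) : Prop :=
  (N = 0 ∧ E = 0 ∧ W = 0 ∧ S = 0) ∨
  (E = 0 ∧ W = 0 ∧ 0 < N ∧ N = S) ∨
  (N = 0 ∧ S = 0 ∧ 0 < E ∧ E = W) ∨
  (0 < E ∧ E = W ∧ E < N ∧ N = S) ∨
  (E = 0 ∧ S = 0 ∧ 0 < N ∧ N = W ∧ N ≤ k) ∨
  (E = 0 ∧ S = 0 ∧ N = W ∧ k < N) ∨
  (N = 0 ∧ W = 0 ∧ 0 < E ∧ E = S ∧ E ≤ k) ∨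
  (N = 0 ∧ W = 0 ∧ E = S ∧ k < E) ∨
  (0 < E ∧ E = S ∧ E < N ∧ N = W ∧ N ≤ k) ∨
  (k < E ∧ E = S ∧ E < N ∧ N = W) ∨
  (0 < N ∧ N = W ∧ N ≤ k ∧ E = S ∧ k < E)

/-- The admissible local configurations of a Schubert pipe puzzle (no bumping
tiles; crossings have the horizontal pipe carrying the smaller label). -/
def LAdm0 (N E W S : ℕ) : Prop :=
  (N = 0 ∧ E = 0 ∧ W = 0 ∧ S = 0) ∨
  (E = 0 ∧ W = 0 ∧ 0 < N ∧ N = S) ∨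
  (N = 0 ∧ S = 0 ∧ 0 < E ∧ E = W) ∨
  (0 < E ∧ E = W ∧ E < N ∧ N = S) ∨
  (E = 0 ∧ S = 0 ∧ 0 < N ∧ N = W) ∨
  (N = 0 ∧ W = 0 ∧ 0 < E ∧ E = S)

/-- The vertex weight `L(x; N, E, W, S)` of the lattice model (equivalently, the
weight of the corresponding pipe-puzzle tile), with spectral parameter `x`. -/
def Lwt {K : Type*} [Field K] (β : K) (k : ℕ) (x : K) (N E W S : ℕ) : K :=
  if N = 0 ∧ E = 0 ∧ W = 0 ∧ S = 0 then x
  else if E = 0 ∧ W = 0 ∧ 0 < N ∧ N = S then 1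
  else if N = 0 ∧ S = 0 ∧ 0 < E ∧ E = W then 1
  else if 0 < E ∧ E = W ∧ E < N ∧ N = S then 1
  else if E = 0 ∧ S = 0 ∧ 0 < N ∧ N = W ∧ N ≤ k then 1 + β * x
  else if E = 0 ∧ S = 0 ∧ N = W ∧ k < N then 1
  else if N = 0 ∧ W = 0 ∧ 0 < E ∧ E = S ∧ E ≤ k then 1
  else if N = 0 ∧ W = 0 ∧ E = S ∧ k < E then 1 + β * x
  else if 0 < E ∧ E = S ∧ E < N ∧ N = W ∧ N ≤ k then β
  else if k < E ∧ E = S ∧ E < N ∧ N = W then β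
  else if 0 < N ∧ N = W ∧ N ≤ k ∧ E = S ∧ k < E then β * (1 + β * x)
  else 0

/-- The set of pipe puzzles for `(u, v, w)` (with separated-descent parameter `k`),
encoded as admissible states of the lattice model. -/
def PP (n k : ℕ) (u v w : Equiv.Perm ℕ) : Set (GridState n) :=
  {sst | BoundaryCond n k u v w sst ∧
    ∀ i j : Fin n, LAdm k (labN sst i j) (labE sst i j) (labW sst i j) (labS sst i j)}

/-- The set of Schubert pipe puzzles for `(u, v, w)`. -/
def PP0 (n k : ℕ) (u v w : Equiv.Perm ℕ) : Set (GridState n) :=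
  {sst | BoundaryCond n k u v w sst ∧
    ∀ i j : Fin n, LAdm0 (labN sst i j) (labE sst i j) (labW sst i j) (labS sst i j)}

/-- The weight `wt(π)` of a pipe puzzle: the product over all tiles, the tile in
row `i` and column `j` having spectral parameter `t_j ⊖ y_i`. -/
def stateWt {K : Type*} [Field K] (β : K) (k : ℕ) (t y : ℕ → K) {n : ℕ}
    (sst : GridState n) : K :=
  ∏ i : Fin n, ∏ j : Fin n,
    Lwt β k (ominus β (t (j : ℕ)) (y (i : ℕ)))
      (labN sst i j) (labE sst i j) (labW sst i j) (labS sst i j)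

/-- The Schubert weight `wt₀(π)`: the product of `t_j - y_i` over the positions
`(i, j)` of the empty tiles. -/
def stateWt0 {K : Type*} [Field K] (t y : ℕ → K) {n : ℕ} (sst : GridState n) : K :=
  ∏ i : Fin n, ∏ j : Fin n,
    if labN sst i j = 0 ∧ labE sst i j = 0 ∧ labW sst i j = 0 ∧ labS sst i j = 0
    then t (j : ℕ) - y (i : ℕ) else 1

/-! ### Permutations of `ℕ` with finite support -/

/-- The inversion set of a permutation. -/
def invSet (w : Equiv.Perm ℕ) : Set (ℕ × ℕ) := {p | p.1 < p.2 ∧ w p.2 < w p.1}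

lemma len_eq_ncard_invSet (w : Equiv.Perm ℕ) : len w = (invSet w).ncard := rfl

lemma InSn.apply_lt {n : ℕ} {w : Equiv.Perm ℕ} (h : InSn n w) {j : ℕ} (hj : j < n) :
    w j < n := by
  by_contra hc
  have := w.injective (h (w j) (by omega))
  omega

lemma FinPerm.inSn {w : Equiv.Perm ℕ} (h : FinPerm w) : ∃ n, InSn n w := h

lemma InSn.finPerm {n : ℕ} {w : Equiv.Perm ℕ} (h : InSn n w) : FinPerm w := ⟨n, h⟩

lemma InSn.mul {n : ℕ} {v w : Equiv.Perm ℕ} (hv : InSn n v) (hw : InSn n w) :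
    InSn n (v * w) := fun j hj => by
  rw [Equiv.Perm.mul_apply, hw j hj, hv j hj]

lemma InSn.inv {n : ℕ} {w : Equiv.Perm ℕ} (hw : InSn n w) : InSn n w⁻¹ := fun j hj => by
  rw [Equiv.Perm.inv_eq_iff_eq, hw j hj]

lemma InSn.mono {m n : ℕ} (hmn : m ≤ n) {w : Equiv.Perm ℕ} (hw : InSn m w) : InSn n w :=
  fun j hj => hw j (hmn.trans hj)

lemma FinPerm.mul {v w : Equiv.Perm ℕ} (hv : FinPerm v) (hw : FinPerm w) :
    FinPerm (v * w) := by
  obtain ⟨m, hm⟩ := hv.inSn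
  obtain ⟨n, hn⟩ := hw.inSn
  exact ((hm.mono (le_max_left m n)).mul (hn.mono (le_max_right m n))).finPerm

lemma FinPerm.inv {w : Equiv.Perm ℕ} (hw : FinPerm w) : FinPerm w⁻¹ :=
  let ⟨_, hn⟩ := hw.inSn
  hn.inv.finPerm

lemma finPerm_one : FinPerm 1 := ⟨0, fun _ _ => rfl⟩

lemma inSn_sTr {n i : ℕ} (h : i + 1 < n) : InSn n (sTr i) := fun j hj =>
  Equiv.swap_apply_of_ne_of_ne (by omega) (by omega)

lemma finPerm_sTr (i : ℕ) : FinPerm (sTr i) := (inSn_sTr (Nat.lt_succ_self (i + 1))).finPerm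

@[simp] lemma sTr_mul_self (i : ℕ) : sTr i * sTr i = 1 := Equiv.swap_mul_self _ _

@[simp] lemma sTr_inv (i : ℕ) : (sTr i)⁻¹ = sTr i := Equiv.swap_inv _ _

@[simp] lemma mul_sTr_mul_sTr (w : Equiv.Perm ℕ) (i : ℕ) : w * sTr i * sTr i = w := by
  rw [mul_assoc, sTr_mul_self, mul_one]

@[simp] lemma sTr_left (i : ℕ) : sTr i i = i + 1 := Equiv.swap_apply_left _ _

@[simp] lemma sTr_right (i : ℕ) : sTr i (i + 1) = i := Equiv.swap_apply_right _ _

lemma sTr_apply (i j : ℕ) :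
    sTr i j = if j = i then i + 1 else if j = i + 1 then i else j :=
  Equiv.swap_apply_def _ _ _

lemma finPerm_mul_sTr_iff {w : Equiv.Perm ℕ} {i : ℕ} : FinPerm (w * sTr i) ↔ FinPerm w :=
  ⟨fun h => by simpa using h.mul (finPerm_sTr i), fun h => h.mul (finPerm_sTr i)⟩

lemma InSn.invSet_subset {n : ℕ} {w : Equiv.Perm ℕ} (h : InSn n w) :
    invSet w ⊆ (Finset.range n ×ˢ Finset.range n : Finset (ℕ × ℕ)) := by
  rintro ⟨p, q⟩ ⟨hpq, hw⟩
  simp only at hpq hw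
  have hq : q < n := by
    by_contra hq
    rw [h q (by omega)] at hw
    rcases lt_or_ge p n with hp | hp
    · have := h.apply_lt hp
      omega
    · rw [h p hp] at hw
      omega
  simp only [Finset.coe_product, Finset.coe_range, Set.mem_prod, Set.mem_Iio]
  omega

lemma FinPerm.finite_invSet {w : Equiv.Perm ℕ} (h : FinPerm w) : (invSet w).Finite :=
  let ⟨_, hn⟩ := h.inSn
  (Finset.finite_toSet _).subset hn.invSet_subset

lemma InSn.len_le {n : ℕ} {w : Equiv.Perm ℕ} (h : InSn n w) : len w ≤ n * n := by
  have := Set.ncard_le_ncard h.invSet_subset (Finset.finite_toSet _)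
  rwa [Set.ncard_coe_finset, Finset.card_product, Finset.card_range] at this

lemma len_mul_le {v w : Equiv.Perm ℕ} (hv : FinPerm v) (hw : FinPerm w) :
    len (v * w) ≤ len v + len w := by
  have hinj : Function.Injective (Prod.map w w) := w.injective.prodMap w.injective
  have hfin : (Prod.map w w ⁻¹' invSet v).Finite := hv.finite_invSet.preimage hinj.injOn
  have hsub : invSet (v * w) ⊆ Prod.map w w ⁻¹' invSet v ∪ invSet w := by
    rintro ⟨p, q⟩ ⟨hpq, hvw⟩
    rcases lt_or_ge (w q) (w p) with h | h
    · exact Or.inr ⟨hpq, h⟩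
    · exact Or.inl ⟨lt_of_le_of_ne h (w.injective.ne hpq.ne), hvw⟩
  calc len (v * w) ≤ (Prod.map w w ⁻¹' invSet v ∪ invSet w).ncard :=
        Set.ncard_le_ncard hsub (hfin.union hw.finite_invSet)
    _ ≤ (Prod.map w w ⁻¹' invSet v).ncard + (invSet w).ncard := Set.ncard_union_le _ _
    _ ≤ len v + len w := by
        refine Nat.add_le_add_right ?_ _
        refine Set.ncard_le_ncard_of_injOn (Prod.map w w) (fun p hp => hp) hinj.injOn
          hv.finite_invSet

lemma len_mul_sTr_of_lt {w : Equiv.Perm ℕ} (hw : FinPerm w) {i : ℕ} (h : w i < w (i + 1)) :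
    len (w * sTr i) = len w + 1 := by
  have hinj : Function.Injective (Prod.map (sTr i) (sTr i)) :=
    (sTr i).injective.prodMap (sTr i).injective
  have heq : invSet (w * sTr i) = insert (i, i + 1) (Prod.map (sTr i) (sTr i) '' invSet w) := by
    ext ⟨p, q⟩
    simp only [invSet, Set.mem_insert_iff, Set.mem_image, Set.mem_ofPred_eq, Prod.exists,
      Prod.map_apply, Prod.mk.injEq, Equiv.Perm.mul_apply]
    constructor
    · rintro ⟨hpq, hlt⟩
      by_cases hi : p = i ∧ q = i + 1
      · exact Or.inl hi
      · refine Or.inr ⟨sTr i p, sTr i q, ⟨?_, hlt⟩, ?_, ?_⟩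
        · rw [sTr_apply, sTr_apply]
          split_ifs <;> omega
        · rw [← Equiv.Perm.mul_apply, sTr_mul_self, Equiv.Perm.one_apply]
        · rw [← Equiv.Perm.mul_apply, sTr_mul_self, Equiv.Perm.one_apply]
    · rintro (⟨rfl, rfl⟩ | ⟨a, b, ⟨hab, hlt⟩, rfl, rfl⟩)
      · simpa using h
      · have hi : ¬ (a = i ∧ b = i + 1) := by
          rintro ⟨rfl, rfl⟩
          omega
        rw [← Equiv.Perm.mul_apply (sTr i), ← Equiv.Perm.mul_apply (sTr i), sTr_mul_self]
        refine ⟨?_, hlt⟩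
        rw [sTr_apply, sTr_apply]
        split_ifs <;> omega
  have hmem : (i, i + 1) ∉ Prod.map (sTr i) (sTr i) '' invSet w := by
    rintro ⟨⟨a, b⟩, ⟨hab, -⟩, hE⟩
    rw [Prod.map_apply, Prod.mk.injEq, sTr_apply, sTr_apply] at hE
    obtain ⟨h1, h2⟩ := hE
    simp only at hab
    split_ifs at h1 h2 <;> omega
  rw [len_eq_ncard_invSet, heq, Set.ncard_insert_of_notMem hmem (hw.finite_invSet.image _),
    Set.ncard_image_of_injective _ hinj, len_eq_ncard_invSet]

lemma len_mul_sTr_of_gt {w : Equiv.Perm ℕ} (hw : FinPerm w) {i : ℕ} (h : w (i + 1) < w i) :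
    len (w * sTr i) + 1 = len w := by
  have := len_mul_sTr_of_lt (hw.mul (finPerm_sTr i)) (i := i) (by simpa using h)
  rw [mul_sTr_mul_sTr] at this
  exact this.symm

lemma apply_lt_of_not_gt {w : Equiv.Perm ℕ} {i : ℕ} (h : ¬ w (i + 1) < w i) :
    w i < w (i + 1) :=
  lt_of_le_of_ne (not_lt.mp h) (w.injective.ne (Nat.lt_succ_self i).ne)

lemma eq_one_of_strictMono {w : Equiv.Perm ℕ} (h : StrictMono w) : w = 1 := by
  have : OrderIso.ofRelIsoLT ⟨w, h.lt_iff_lt⟩ = OrderIso.refl ℕ := Subsingleton.elim _ _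
  ext j
  exact DFunLike.congr_fun this j

lemma exists_descent {w : Equiv.Perm ℕ} (h : w ≠ 1) : ∃ i, w (i + 1) < w i := by
  by_contra! hc
  exact h (eq_one_of_strictMono (strictMono_nat_of_lt_succ fun i =>
    apply_lt_of_not_gt (not_lt.mpr (hc i))))

lemma len_one : len 1 = 0 := by
  rw [len_eq_ncard_invSet, Set.ncard_eq_zero finPerm_one.finite_invSet]
  ext ⟨p, q⟩
  simp only [invSet, Equiv.Perm.one_apply, Set.mem_ofPred_eq, Set.mem_empty_iff_false, iff_false]
  omega

lemma eq_one_of_len_eq_zero {w : Equiv.Perm ℕ} (hw : FinPerm w) (h : len w = 0) : w = 1 := by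
  by_contra hne
  obtain ⟨i, hi⟩ := exists_descent hne
  have := len_mul_sTr_of_gt hw hi
  omega

lemma len_sTr (i : ℕ) : len (sTr i) = 1 := by
  have := len_mul_sTr_of_lt finPerm_one (i := i) (by simp)
  rwa [one_mul, len_one] at this

/-- Induction on finitely supported permutations by removing descents. -/
lemma FinPerm.descent_induction {Q : Equiv.Perm ℕ → Prop} (h1 : Q 1)
    (hstep : ∀ w i, FinPerm w → w (i + 1) < w i →
      Q (w * sTr i) → Q w) {w : Equiv.Perm ℕ} (hw : FinPerm w) : Q w := by
  induction hl : len w using Nat.strong_induction_on generalizing w with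
  | _ l ih =>
    by_cases hne : w = 1
    · exact hne ▸ h1
    · obtain ⟨i, hi⟩ := exists_descent hne
      have := len_mul_sTr_of_gt hw hi
      exact hstep w i hw hi (ih _ (by omega) (hw.mul (finPerm_sTr i)) rfl)

lemma inSn_revPerm (n : ℕ) : InSn n (revPerm n) := fun j hj => by
  simp [revPerm, not_lt.mpr hj]

lemma revPerm_zero : revPerm 0 = 1 := by
  ext j
  simp [revPerm]

lemma InSn.eq_revPerm {n : ℕ} {w : Equiv.Perm ℕ} (hw : InSn n w)
    (h : ∀ i, i + 1 < n → w (i + 1) < w i) : w = revPerm n := by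
  have hle : ∀ i, i < n → w i + i + 1 ≤ n := by
    intro i
    induction i with
    | zero => intro hi; have := hw.apply_lt hi; omega
    | succ i ih => intro hi; have := ih (by omega); have := h i hi; omega
  have hge : ∀ j, j < n → j ≤ w (n - 1 - j) := by
    intro j
    induction j with
    | zero => intro _; omega
    | succ j ih =>
      intro hj
      have h1 := ih (by omega)
      have h2 := h (n - 1 - (j + 1)) (by omega)
      rw [show n - 1 - (j + 1) + 1 = n - 1 - j by omega] at h2
      omega
  ext i
  by_cases hi : i < n
  · have h1 := hle i hi
    have h2 := hge (n - 1 - i) (by omega)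
    rw [show n - 1 - (n - 1 - i) = i by omega] at h2
    simp only [revPerm, Equiv.coe_fn_mk, if_pos hi]
    omega
  · rw [hw i (by omega), inSn_revPerm n i (by omega)]

/-- Induction on `S_n` starting from the longest element. -/
lemma InSn.ascent_induction {n : ℕ} {Q : Equiv.Perm ℕ → Prop} (hrev : Q (revPerm n))
    (hstep : ∀ w i, InSn n w → i + 1 < n → w (i + 1) < w i → Q w → Q (w * sTr i))
    {w : Equiv.Perm ℕ} (hw : InSn n w) : Q w := by
  induction hl : n * n - len w using Nat.strong_induction_on generalizing w with
  | _ l ih =>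
    by_cases hdes : ∀ i, i + 1 < n → w (i + 1) < w i
    · exact hw.eq_revPerm hdes ▸ hrev
    · push Not at hdes
      obtain ⟨i, hi, hle⟩ := hdes
      have hlt := apply_lt_of_not_gt (not_lt.mpr hle)
      have hws := hw.mul (inSn_sTr hi)
      have h1 := len_mul_sTr_of_lt hw.finPerm hlt
      have h2 := hws.len_le
      have := hstep (w * sTr i) i hws hi (by simpa using hlt) (ih _ (by omega) hws rfl)
      rwa [mul_sTr_mul_sTr] at this

/-! ### Schubert polynomials -/

section Schubert

variable {K : Type*} [Field K]

/-- The defining properties of the single Schubert polynomials. -/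
structure SchubertFamily (s : Equiv.Perm ℕ → MvPolynomial ℕ K) : Prop where
  revPerm_eq : ∀ n, s (revPerm n) = ∏ i ∈ Finset.range n, X i ^ (n - 1 - i)
  descent : ∀ (w : Equiv.Perm ℕ) (i : ℕ), w (i + 1) < w i →
    (X i - X (i + 1)) * s (w * sTr i) = s w - rename (sTr i) (s w)

lemma GrothFamily.schubertFamily {G : (ℕ → K) → Equiv.Perm ℕ → MvPolynomial ℕ K}
    (hG : GrothFamily (0 : K) G) : SchubertFamily (G fun _ => 0) := by
  obtain ⟨h1, h2⟩ := hG (fun _ => 0) (by simp)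
  refine ⟨fun n => ?_, fun w i hi => ?_⟩
  · rw [h1 n]
    simp
  · rw [h2 w i hi]
    simp [sTr]

lemma X_sub_X_succ_ne_zero (i : ℕ) : (X i - X (i + 1) : MvPolynomial ℕ K) ≠ 0 :=
  sub_ne_zero.mpr fun h => (Nat.lt_succ_self i).ne (X_injective h)

@[simp] lemma rename_sTr_rename_sTr (i : ℕ) (f : MvPolynomial ℕ K) :
    rename (sTr i) (rename (sTr i) f) = f := by
  rw [rename_rename, ← Equiv.Perm.coe_mul, sTr_mul_self, Equiv.Perm.coe_one, rename_id_apply]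

namespace SchubertFamily

variable {s : Equiv.Perm ℕ → MvPolynomial ℕ K}

lemma one (hs : SchubertFamily s) : s 1 = 1 := by
  simpa [revPerm_zero] using hs.revPerm_eq 0

lemma rename_of_ascent (hs : SchubertFamily s) {w : Equiv.Perm ℕ} {i : ℕ}
    (h : w i < w (i + 1)) : rename (sTr i) (s w) = s w := by
  have h1 := hs.descent (w * sTr i) i (by simpa using h)
  rw [mul_sTr_mul_sTr] at h1
  have h2 := congrArg (rename (sTr i)) h1
  simp only [map_mul, map_sub, rename_X, sTr_left, sTr_right, rename_sTr_rename_sTr] at h2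
  refine mul_left_cancel₀ (X_sub_X_succ_ne_zero (K := K) i) ?_
  linear_combination -h1 - h2

lemma degreeOf_le (hs : SchubertFamily s) {n : ℕ} {w : Equiv.Perm ℕ} (hw : InSn n w) (j : ℕ) :
    degreeOf j (s w) ≤ n - 1 - j := by
  refine InSn.ascent_induction (Q := fun w => ∀ j, degreeOf j (s w) ≤ n - 1 - j)
    (fun j => ?_) (fun w i hw hi hdes ih j => ?_) hw j
  · rw [hs.revPerm_eq]
    refine (degreeOf_prod_le _ _ _).trans ?_
    by_cases hj : j < n
    · rw [Finset.sum_eq_single_of_mem j (Finset.mem_range.mpr hj)]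
      · simp
      · intro b _ hb
        exact degreeOf_X_pow_of_ne _ hb.symm
    · refine (Finset.sum_eq_zero fun b hb => ?_).trans_le (Nat.zero_le _)
      exact degreeOf_X_pow_of_ne _ (by have := Finset.mem_range.mp hb; omega)
  · by_cases h0 : s (w * sTr i) = 0
    · simp [h0]
    have hsub := degreeOf_sub_le j (s w) (rename (sTr i) (s w))
    rw [← hs.descent w i hdes, degreeOf_mul_eq (X_sub_X_succ_ne_zero i) h0] at hsub
    have hren : degreeOf j (rename (sTr i) (s w)) = degreeOf (sTr i j) (s w) := by
      have := degreeOf_rename_of_injective (p := s w) (sTr i).injective (sTr i j)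
      rwa [← Equiv.Perm.mul_apply, sTr_mul_self] at this
    have hX : j = i ∨ j = i + 1 → 1 ≤ degreeOf j (X i - X (i + 1) : MvPolynomial ℕ K) := by
      intro hj
      refine le_trans (by simp) (monomial_le_degreeOf j (m := Finsupp.single j 1) ?_)
      rw [mem_support_iff, coeff_sub, coeff_X, coeff_X]
      rcases hj with rfl | rfl <;> simp [Finsupp.single_left_inj]
    have h1 := ih j
    have h2 := ih (sTr i j)
    rw [sTr_apply] at h2
    rw [hren, sTr_apply] at hsub
    split_ifs at h2 hsub
    · have := hX (by omega)
      omega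
    · have := hX (by omega)
      subst j
      omega
    · omega

end SchubertFamily

/-- The exponent vector of a sub-staircase monomial. -/
def staircaseExponent (n : ℕ) (a : (i : Fin n) → Fin (n - i)) : ℕ →₀ ℕ :=
  ∑ i : Fin n, Finsupp.single (i : ℕ) (a i : ℕ)

lemma staircaseExponent_apply_of_lt {n : ℕ} (a : (i : Fin n) → Fin (n - i)) (i : Fin n) :
    staircaseExponent n a i = a i := by
  rw [staircaseExponent, Finsupp.finsetSum_apply, Finset.sum_eq_single_of_mem i (Finset.mem_univ _)]
  · simp
  · intro b _ hb
    exact Finsupp.single_eq_of_ne (fun h => hb (Fin.ext h.symm))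

lemma staircaseExponent_apply_of_le {n : ℕ} (a : (i : Fin n) → Fin (n - i)) {j : ℕ}
    (hj : n ≤ j) : staircaseExponent n a j = 0 := by
  rw [staircaseExponent, Finsupp.finsetSum_apply]
  refine Finset.sum_eq_zero fun b _ => Finsupp.single_eq_of_ne ?_
  have := b.isLt
  omega

lemma mem_span_staircase {n : ℕ} {f : MvPolynomial ℕ K}
    (hf : ∀ j, degreeOf j f ≤ n - 1 - j) :
    f ∈ Submodule.span K
      (Set.range fun a => (monomial (staircaseExponent n a) 1 : MvPolynomial ℕ K)) := by
  rw [← support_sum_monomial_coeff f]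
  refine Submodule.sum_mem _ fun m hm => ?_
  have hle : ∀ j, m j ≤ n - 1 - j := fun j => (monomial_le_degreeOf j hm).trans (hf j)
  have hmono : monomial m (coeff m f) = coeff m f • (monomial m 1 : MvPolynomial ℕ K) := by
    rw [smul_monomial, smul_eq_mul, mul_one]
  rw [hmono]
  refine Submodule.smul_mem _ _ (Submodule.subset_span
    ⟨fun i => ⟨m i, by have := hle i; have := i.isLt; omega⟩, ?_⟩)
  refine congrArg (fun a => monomial a 1) (Finsupp.ext fun j => ?_)
  by_cases hj : j < n
  · exact staircaseExponent_apply_of_lt _ ⟨j, hj⟩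
  · rw [staircaseExponent_apply_of_le _ (by omega)]
    have := hle j
    omega

/-- The action of divided difference operators on Schubert polynomials. -/
def DividedDifferenceFamily (s : Equiv.Perm ℕ → MvPolynomial ℕ K)
    (D : Equiv.Perm ℕ → MvPolynomial ℕ K →ₗ[K] MvPolynomial ℕ K) : Prop :=
  ∀ u w : Equiv.Perm ℕ, FinPerm u → FinPerm w →
    D w (s u) = if len (u * w⁻¹) + len w = len u then s (u * w⁻¹) else 0

namespace DividedDifferenceFamily

variable {s : Equiv.Perm ℕ → MvPolynomial ℕ K}
  {D : Equiv.Perm ℕ → MvPolynomial ℕ K →ₗ[K] MvPolynomial ℕ K}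

lemma apply_self (hD : DividedDifferenceFamily s D) (hs : SchubertFamily s)
    {w : Equiv.Perm ℕ} (hw : FinPerm w) : D w (s w) = 1 := by
  rw [hD w w hw hw]
  simp [len_one, hs.one]

lemma apply_of_len_le (hD : DividedDifferenceFamily s D) {u w : Equiv.Perm ℕ}
    (hu : FinPerm u) (hw : FinPerm w) (hlen : len u ≤ len w) (hne : u ≠ w) :
    D w (s u) = 0 := by
  rw [hD u w hu hw, if_neg]
  intro h
  exact hne (mul_inv_eq_one.mp (eq_one_of_len_eq_zero (hu.mul hw.inv) (by omega)))

lemma inSn_ofSubtype {n : ℕ} (σ : Equiv.Perm {i : ℕ // i ∈ Finset.range n}) :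
    InSn n (Equiv.Perm.ofSubtype σ) := fun _ hj =>
  Equiv.Perm.ofSubtype_apply_of_not_mem σ (by simpa using hj)

lemma linearIndependent (hD : DividedDifferenceFamily s D) (hs : SchubertFamily s) (n : ℕ) :
    LinearIndependent K
      fun σ : Equiv.Perm {i : ℕ // i ∈ Finset.range n} => s (Equiv.Perm.ofSubtype σ) := by
  classical
  rw [Fintype.linearIndependent_iff]
  intro g hg
  by_contra! hne
  obtain ⟨σ, hσ, hmax⟩ := Finset.exists_max_image
    (Finset.univ.filter fun σ : Equiv.Perm {i : ℕ // i ∈ Finset.range n} => g σ ≠ 0)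
    (fun σ => len (Equiv.Perm.ofSubtype σ)) (by simpa [Finset.filter_nonempty_iff] using hne)
  have h := congrArg (D (Equiv.Perm.ofSubtype σ)) hg
  rw [map_sum, map_zero, Finset.sum_eq_single_of_mem σ (Finset.mem_univ _), map_smul,
    hD.apply_self hs (inSn_ofSubtype σ).finPerm] at h
  · simp_all
  · intro τ _ hτ
    by_cases h0 : g τ = 0
    · simp [h0]
    · rw [map_smul, hD.apply_of_len_le (inSn_ofSubtype τ).finPerm (inSn_ofSubtype σ).finPerm
        (hmax τ (by simpa using h0)) (Equiv.Perm.ofSubtype_injective.ne hτ), smul_zero]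

lemma card_staircase (n : ℕ) : Fintype.card ((i : Fin n) → Fin (n - i)) = n.factorial := by
  simp only [Fintype.card_pi, Fintype.card_fin]
  rw [Fin.prod_univ_eq_prod_range (fun i => n - i) n, ← Finset.prod_range_reflect,
    ← Finset.prod_range_add_one_eq_factorial]
  refine Finset.prod_congr rfl fun i hi => ?_
  have := Finset.mem_range.mp hi
  omega

/-- Schubert polynomials span the polynomial ring. -/
lemma span_eq_top (hD : DividedDifferenceFamily s D) (hs : SchubertFamily s) :
    Submodule.span K (s '' {w | FinPerm w}) = ⊤ := by
  refine eq_top_iff.mpr fun f _ => ?_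
  obtain ⟨b, hb⟩ : ∃ b, ∀ j ∈ f.vars, j ≤ b :=
    ⟨f.vars.sup id, fun j hj => Finset.le_sup (f := id) hj⟩
  set n := b + f.totalDegree + 1 with hn
  have hf : ∀ j, degreeOf j f ≤ n - 1 - j := by
    intro j
    by_cases hj : j ∈ f.vars
    · have h1 := hb j hj
      have h2 := degreeOf_le_totalDegree f j
      omega
    · refine degreeOf_le_iff.mpr fun m hm => ?_
      rw [mem_support_notMem_vars_zero hm hj]
      exact Nat.zero_le _
  have hle : Submodule.span K
        (Set.range fun σ : Equiv.Perm {i : ℕ // i ∈ Finset.range n} => s (Equiv.Perm.ofSubtype σ)) ≤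
      Submodule.span K
        (Set.range fun a => (monomial (staircaseExponent n a) 1 : MvPolynomial ℕ K)) := by
    rw [Submodule.span_le]
    rintro _ ⟨σ, rfl⟩
    exact mem_span_staircase (hs.degreeOf_le (inSn_ofSubtype σ))
  have : FiniteDimensional K (Submodule.span K
      (Set.range fun a => (monomial (staircaseExponent n a) 1 : MvPolynomial ℕ K))) :=
    FiniteDimensional.span_of_finite K (Set.finite_range _)
  have heq := Submodule.eq_of_le_of_finrank_le hle (by
    rw [finrank_span_eq_card (hD.linearIndependent hs n), Fintype.card_perm,
      Fintype.card_coe, Finset.card_range]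
    exact (finrank_range_le_card _).trans_eq (card_staircase n))
  refine Submodule.span_mono ?_ (heq ▸ mem_span_staircase hf)
  rintro _ ⟨σ, rfl⟩
  exact ⟨_, (inSn_ofSubtype σ).finPerm, rfl⟩

/-- Linear maps agreeing on Schubert polynomials agree. -/
lemma linearMap_ext (hD : DividedDifferenceFamily s D) (hs : SchubertFamily s)
    {M : Type*} [AddCommMonoid M] [Module K M] {φ ψ : MvPolynomial ℕ K →ₗ[K] M}
    (h : ∀ u, FinPerm u → φ (s u) = ψ (s u)) : φ = ψ := by
  refine LinearMap.ext_on (hD.span_eq_top hs) ?_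
  rintro _ ⟨u, hu, rfl⟩
  exact h u hu

lemma one_eq_id (hD : DividedDifferenceFamily s D) (hs : SchubertFamily s) :
    D 1 = LinearMap.id := by
  refine hD.linearMap_ext hs fun u hu => ?_
  rw [hD u 1 hu finPerm_one]
  simp [len_one]

lemma sTr_apply_of_descent (hD : DividedDifferenceFamily s D) {u : Equiv.Perm ℕ}
    (hu : FinPerm u) {i : ℕ} (h : u (i + 1) < u i) : D (sTr i) (s u) = s (u * sTr i) := by
  rw [hD u _ hu (finPerm_sTr i), sTr_inv, len_sTr, if_pos (len_mul_sTr_of_gt hu h)]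

lemma sTr_apply_of_ascent (hD : DividedDifferenceFamily s D) {u : Equiv.Perm ℕ}
    (hu : FinPerm u) {i : ℕ} (h : u i < u (i + 1)) : D (sTr i) (s u) = 0 := by
  rw [hD u _ hu (finPerm_sTr i), sTr_inv, len_sTr, len_mul_sTr_of_lt hu h, if_neg (by omega)]

/-- `D (s_i)` is the divided difference operator `∂_i`. -/
lemma X_sub_X_mul_sTr (hD : DividedDifferenceFamily s D) (hs : SchubertFamily s) (i : ℕ)
    (f : MvPolynomial ℕ K) :
    (X i - X (i + 1)) * D (sTr i) f = f - rename (sTr i) f := by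
  have : (LinearMap.mulLeft K (X i - X (i + 1) : MvPolynomial ℕ K)).comp (D (sTr i)) =
      LinearMap.id - (rename (sTr i)).toLinearMap := by
    refine hD.linearMap_ext hs fun u hu => ?_
    simp only [LinearMap.comp_apply, LinearMap.mulLeft_apply, LinearMap.sub_apply,
      LinearMap.id_apply, AlgHom.toLinearMap_apply]
    by_cases h : u (i + 1) < u i
    · rw [hD.sTr_apply_of_descent hu h, hs.descent u i h]
    · have h' := apply_lt_of_not_gt h
      rw [hD.sTr_apply_of_ascent hu h', hs.rename_of_ascent h', mul_zero, sub_self]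
  exact LinearMap.congr_fun this f

lemma sTr_eq_of_mul_eq (hD : DividedDifferenceFamily s D) (hs : SchubertFamily s) {i : ℕ}
    {f g : MvPolynomial ℕ K} (h : (X i - X (i + 1)) * g = f - rename (sTr i) f) :
    D (sTr i) f = g :=
  mul_left_cancel₀ (X_sub_X_succ_ne_zero i) ((hD.X_sub_X_mul_sTr hs i f).trans h.symm)

lemma sTr_mul (hD : DividedDifferenceFamily s D) (hs : SchubertFamily s) (i : ℕ)
    (f g : MvPolynomial ℕ K) :
    D (sTr i) (f * g) = D (sTr i) f * g + rename (sTr i) f * D (sTr i) g := by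
  refine hD.sTr_eq_of_mul_eq hs ?_
  rw [map_mul]
  linear_combination g * hD.X_sub_X_mul_sTr hs i f +
    rename (sTr i) f * hD.X_sub_X_mul_sTr hs i g

lemma mul_sTr_of_ascent (hD : DividedDifferenceFamily s D) (hs : SchubertFamily s)
    {w : Equiv.Perm ℕ} (hw : FinPerm w) {i : ℕ} (h : w i < w (i + 1)) (f : MvPolynomial ℕ K) :
    D w (D (sTr i) f) = D (w * sTr i) f := by
  have : (D w).comp (D (sTr i)) = D (w * sTr i) := by
    refine hD.linearMap_ext hs fun u hu => ?_
    have hlen := len_mul_sTr_of_lt hw h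
    have hui := hu.mul (finPerm_sTr i)
    rw [LinearMap.comp_apply, hD u _ hu (hw.mul (finPerm_sTr i)), mul_inv_rev, sTr_inv,
      ← mul_assoc, hlen]
    by_cases hdes : u (i + 1) < u i
    · rw [hD.sTr_apply_of_descent hu hdes, hD _ _ hui hw, ← len_mul_sTr_of_gt hu hdes]
      congr 1
      simp only [eq_iff_iff]
      omega
    · have hasc := apply_lt_of_not_gt hdes
      rw [hD.sTr_apply_of_ascent hu hasc, map_zero, if_neg]
      have h1 := len_mul_sTr_of_lt hu hasc
      have h2 := len_mul_le (hui.mul hw.inv) hw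
      rw [inv_mul_cancel_right] at h2
      omega
  exact LinearMap.congr_fun this f

lemma sTr_sTr (hD : DividedDifferenceFamily s D) (hs : SchubertFamily s) (i : ℕ)
    (f : MvPolynomial ℕ K) : D (sTr i) (D (sTr i) f) = 0 := by
  refine hD.sTr_eq_of_mul_eq hs ?_
  have h1 := hD.X_sub_X_mul_sTr hs i f
  have h2 := congrArg (rename (sTr i)) h1
  simp only [map_mul, map_sub, rename_X, sTr_left, sTr_right, rename_sTr_rename_sTr] at h2
  refine mul_left_cancel₀ (X_sub_X_succ_ne_zero (K := K) i) ?_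
  linear_combination -h1 - h2

lemma mul_sTr_of_descent (hD : DividedDifferenceFamily s D) (hs : SchubertFamily s)
    {w : Equiv.Perm ℕ} (hw : FinPerm w) {i : ℕ} (h : w (i + 1) < w i) (f : MvPolynomial ℕ K) :
    D w (D (sTr i) f) = 0 := by
  have := hD.mul_sTr_of_ascent hs (hw.mul (finPerm_sTr i)) (i := i) (by simpa using h)
    (D (sTr i) f)
  rw [mul_sTr_mul_sTr, hD.sTr_sTr hs, map_zero] at this
  exact this.symm

end DividedDifferenceFamily

end Schubert

/-! ### Skew divided differences -/

section Skew

variable {K : Type*} [Field K]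

/-- The defining properties of the skew divided difference operators. -/
structure SkewFamily (D : Equiv.Perm ℕ → MvPolynomial ℕ K →ₗ[K] MvPolynomial ℕ K)
    (Dskew : Equiv.Perm ℕ → Equiv.Perm ℕ → MvPolynomial ℕ K →ₗ[K] MvPolynomial ℕ K) :
    Prop where
  eq_zero : ∀ w v, ¬ FinPerm v → Dskew w v = 0
  finite : ∀ w f, {v | Dskew w v f ≠ 0}.Finite
  leibniz : ∀ w, FinPerm w → ∀ f g, D w (f * g) = ∑ᶠ v, Dskew w v f * D v g

variable {s : Equiv.Perm ℕ → MvPolynomial ℕ K}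
  {D : Equiv.Perm ℕ → MvPolynomial ℕ K →ₗ[K] MvPolynomial ℕ K}
  {Dskew : Equiv.Perm ℕ → Equiv.Perm ℕ → MvPolynomial ℕ K →ₗ[K] MvPolynomial ℕ K}

/-- The left `MvPolynomial ℕ K`-linear combination of the operators `D v` with coefficients `A`,
evaluated at `g`. -/
def operatorSum (D : Equiv.Perm ℕ → MvPolynomial ℕ K →ₗ[K] MvPolynomial ℕ K)
    (g : MvPolynomial ℕ K) :
    (Equiv.Perm ℕ →₀ MvPolynomial ℕ K) →ₗ[MvPolynomial ℕ K] MvPolynomial ℕ K :=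
  Finsupp.linearCombination (MvPolynomial ℕ K) fun v => D v g

lemma operatorSum_apply (g : MvPolynomial ℕ K) (A : Equiv.Perm ℕ →₀ MvPolynomial ℕ K) :
    operatorSum D g A = ∑ v ∈ A.support, A v * D v g := rfl

/-- Divided difference operators are linearly independent over the polynomial ring. -/
lemma DividedDifferenceFamily.eq_zero_of_operatorSum (hD : DividedDifferenceFamily s D)
    (hs : SchubertFamily s) {A : Equiv.Perm ℕ →₀ MvPolynomial ℕ K}
    (hA : ∀ v, ¬ FinPerm v → A v = 0) (h : ∀ g, operatorSum D g A = 0) : A = 0 := by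
  have hfin : ∀ v ∈ A.support, FinPerm v := fun v hv => by
    by_contra hc
    exact Finsupp.mem_support_iff.mp hv (hA v hc)
  by_contra hne
  obtain ⟨v, hv, hmin⟩ := Finset.exists_min_image A.support len
    (Finsupp.support_nonempty_iff.mpr hne)
  have h1 := h (s v)
  rw [operatorSum_apply, Finset.sum_eq_single_of_mem v hv, hD.apply_self hs (hfin v hv),
    mul_one] at h1
  · exact Finsupp.mem_support_iff.mp hv h1
  · intro z hz hzv
    rw [hD.apply_of_len_le (hfin v hv) (hfin z hz) (hmin z hz) hzv.symm, mul_zero]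

namespace SkewFamily

/-- The finitely supported family `v ↦ ∂_{w/v} f`. -/
def coeffs (hK : SkewFamily D Dskew) (w : Equiv.Perm ℕ) (f : MvPolynomial ℕ K) :
    Equiv.Perm ℕ →₀ MvPolynomial ℕ K :=
  Finsupp.ofSupportFinite (fun v => Dskew w v f) (hK.finite w f)

lemma coeffs_apply (hK : SkewFamily D Dskew) (w v : Equiv.Perm ℕ) (f : MvPolynomial ℕ K) :
    hK.coeffs w f v = Dskew w v f := rfl

lemma coeffs_apply_of_not_finPerm (hK : SkewFamily D Dskew) (w : Equiv.Perm ℕ)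
    {v : Equiv.Perm ℕ} (hv : ¬ FinPerm v) (f : MvPolynomial ℕ K) : hK.coeffs w f v = 0 := by
  rw [coeffs_apply, hK.eq_zero w v hv, LinearMap.zero_apply]

lemma operatorSum_coeffs (hK : SkewFamily D Dskew) {w : Equiv.Perm ℕ} (hw : FinPerm w)
    (f g : MvPolynomial ℕ K) : operatorSum D g (hK.coeffs w f) = D w (f * g) := by
  rw [hK.leibniz w hw, operatorSum_apply]
  refine (finsum_eq_sum_of_support_subset _ fun v hv => ?_).symm
  rw [Function.mem_support] at hv
  exact Finsupp.mem_support_iff.mpr (left_ne_zero_of_mul hv)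

lemma coeffs_eq (hK : SkewFamily D Dskew) (hD : DividedDifferenceFamily s D)
    (hs : SchubertFamily s) {w : Equiv.Perm ℕ} (hw : FinPerm w) {f : MvPolynomial ℕ K}
    {A : Equiv.Perm ℕ →₀ MvPolynomial ℕ K} (hA : ∀ v, ¬ FinPerm v → A v = 0)
    (h : ∀ g, operatorSum D g A = D w (f * g)) : hK.coeffs w f = A := by
  refine sub_eq_zero.mp (hD.eq_zero_of_operatorSum hs (fun v hv => ?_) fun g => ?_)
  · rw [Finsupp.sub_apply, hA v hv, hK.coeffs_apply_of_not_finPerm w hv, sub_zero]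
  · rw [map_sub, h, hK.operatorSum_coeffs hw, sub_self]

open Classical in
lemma one_apply (hK : SkewFamily D Dskew) (hD : DividedDifferenceFamily s D)
    (hs : SchubertFamily s) (v : Equiv.Perm ℕ) (f : MvPolynomial ℕ K) :
    Dskew 1 v f = if v = 1 then f else 0 := by
  have := hK.coeffs_eq hD hs finPerm_one (f := f) (A := Finsupp.single 1 f)
    (fun v hv => Finsupp.single_eq_of_ne fun h => hv (h ▸ finPerm_one))
    (fun g => by simp [operatorSum, hD.one_eq_id hs])
  rw [← hK.coeffs_apply, this, Finsupp.single_apply]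
  simp only [eq_comm]

open Classical in
lemma apply_one (hK : SkewFamily D Dskew) (hD : DividedDifferenceFamily s D)
    (hs : SchubertFamily s) {w : Equiv.Perm ℕ} (hw : FinPerm w) (v : Equiv.Perm ℕ) :
    Dskew w v 1 = if v = w then 1 else 0 := by
  have := hK.coeffs_eq hD hs hw (f := 1) (A := Finsupp.single w 1)
    (fun v hv => Finsupp.single_eq_of_ne fun h => hv (h ▸ hw))
    (fun g => by simp [operatorSum])
  rw [← hK.coeffs_apply, this, Finsupp.single_apply]
  simp only [eq_comm]

/-- Skew divided differences of a product. -/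
lemma apply_mul (hK : SkewFamily D Dskew) (hD : DividedDifferenceFamily s D)
    (hs : SchubertFamily s) {w : Equiv.Perm ℕ} (hw : FinPerm w) (v : Equiv.Perm ℕ)
    (e f : MvPolynomial ℕ K) :
    Dskew w v (e * f) = ∑ z ∈ (hK.coeffs w e).support, Dskew w z e * Dskew z v f := by
  have := hK.coeffs_eq hD hs hw (f := e * f)
    (A := ∑ z ∈ (hK.coeffs w e).support, Dskew w z e • hK.coeffs z f)
    (fun v hv => by
      rw [Finsupp.finsetSum_apply]
      refine Finset.sum_eq_zero fun z _ => ?_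
      rw [Finsupp.smul_apply, hK.coeffs_apply_of_not_finPerm z hv, smul_zero])
    (fun g => by
      rw [mul_assoc, ← hK.operatorSum_coeffs hw, map_sum,
        operatorSum_apply (A := hK.coeffs w e)]
      refine Finset.sum_congr rfl fun z hz => ?_
      have hzf : FinPerm z := by
        by_contra hc
        exact Finsupp.mem_support_iff.mp hz (hK.coeffs_apply_of_not_finPerm w hc e)
      rw [map_smul, hK.operatorSum_coeffs hzf, hK.coeffs_apply, smul_eq_mul])
  rw [← hK.coeffs_apply, this, Finsupp.finsetSum_apply]
  rfl

/-- The recursion for skew divided differences obtained by removing a descent of `w`. -/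
lemma apply_of_descent (hK : SkewFamily D Dskew) (hD : DividedDifferenceFamily s D)
    (hs : SchubertFamily s) {w : Equiv.Perm ℕ} (hw : FinPerm w) {i : ℕ}
    (hdes : w (i + 1) < w i) (v : Equiv.Perm ℕ) (f : MvPolynomial ℕ K) :
    Dskew w v f = Dskew (w * sTr i) v (D (sTr i) f) +
      if v (i + 1) < v i then Dskew (w * sTr i) (v * sTr i) (rename (sTr i) f) else 0 := by
  have hw' := hw.mul (finPerm_sTr i)
  have hasc : (w * sTr i) i < (w * sTr i) (i + 1) := by simpa using hdes
  set P : Equiv.Perm ℕ → Prop := fun z => z i < z (i + 1)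
  set B := ((hK.coeffs (w * sTr i) (rename (sTr i) f)).filter P).mapDomain
    (Equiv.mulRight (sTr i)) with hB
  have hBv : ∀ v, B v =
      if v (i + 1) < v i then Dskew (w * sTr i) (v * sTr i) (rename (sTr i) f) else 0 := by
    intro v
    rw [hB, ← Finsupp.equivMapDomain_eq_mapDomain, Finsupp.equivMapDomain_apply,
      Finsupp.filter_apply]
    simp [P, coeffs_apply]
  have := hK.coeffs_eq hD hs hw (f := f) (A := hK.coeffs (w * sTr i) (D (sTr i) f) + B)
    (fun v hv => by
      rw [Finsupp.add_apply, hK.coeffs_apply_of_not_finPerm _ hv, hBv, zero_add,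
        hK.eq_zero _ _ (mt finPerm_mul_sTr_iff.mp hv), LinearMap.zero_apply, ite_self])
    (fun g => by
      have h1 := hD.mul_sTr_of_ascent hs hw' hasc (f * g)
      rw [mul_sTr_mul_sTr, hD.sTr_mul hs, map_add] at h1
      rw [map_add, hK.operatorSum_coeffs hw', ← h1, add_right_inj,
        ← hK.operatorSum_coeffs hw', operatorSum, Finsupp.linearCombination_mapDomain,
        operatorSum, Finsupp.linearCombination_apply, Finsupp.linearCombination_apply,
        Finsupp.sum_filter_index, Finsupp.sum, Finsupp.support_filter, Finset.sum_filter]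
      refine Finset.sum_congr rfl fun z hz => ?_
      have hzf : FinPerm z := by
        by_contra hc
        exact Finsupp.mem_support_iff.mp hz (hK.coeffs_apply_of_not_finPerm _ hc _)
      by_cases hP : z (i + 1) < z i
      · rw [hD.mul_sTr_of_descent hs hzf hP, smul_zero, if_neg (not_lt.mpr hP.le)]
      · have hP' := apply_lt_of_not_gt hP
        rw [hD.mul_sTr_of_ascent hs hzf hP', if_pos hP']
        rfl)
  rw [← hK.coeffs_apply, this, Finsupp.add_apply, hBv, hK.coeffs_apply]

lemma apply_sTr_of_ascent (hK : SkewFamily D Dskew) (hD : DividedDifferenceFamily s D)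
    (hs : SchubertFamily s) {w v : Equiv.Perm ℕ} (hw : FinPerm w) {i : ℕ}
    (hasc : w i < w (i + 1)) (hv : v i < v (i + 1)) (f : MvPolynomial ℕ K) :
    Dskew w v (D (sTr i) f) = Dskew (w * sTr i) v f := by
  have := hK.apply_of_descent hD hs (hw.mul (finPerm_sTr i)) (i := i) (by simpa using hasc) v f
  rw [this, mul_sTr_mul_sTr, if_neg (not_lt.mpr hv.le), add_zero]

lemma apply_sTr_of_descent (hK : SkewFamily D Dskew) (hD : DividedDifferenceFamily s D)
    (hs : SchubertFamily s) {w v : Equiv.Perm ℕ} (hw : FinPerm w) {i : ℕ}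
    (hdes : w (i + 1) < w i) (hv : v i < v (i + 1)) (f : MvPolynomial ℕ K) :
    Dskew w v (D (sTr i) f) = 0 := by
  rw [hK.apply_of_descent hD hs hw hdes, hD.sTr_sTr hs, map_zero,
    if_neg (not_lt.mpr hv.le), add_zero]

end SkewFamily

end Skew

/-! ### Positivity -/

section Positivity

variable {K : Type*} [Field K]

variable (K) in
/-- The semiring of polynomials with natural number coefficients. -/
def natPolynomials : Subsemiring (MvPolynomial ℕ K) :=
  (MvPolynomial.map (Nat.castRingHom K)).rangeS

lemma X_mem_natPolynomials (i : ℕ) : X i ∈ natPolynomials K :=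
  ⟨X i, map_X _ i⟩

lemma exists_coeff_eq_of_mem_natPolynomials {f : MvPolynomial ℕ K}
    (hf : f ∈ natPolynomials K) (m : ℕ →₀ ℕ) : ∃ a : ℕ, coeff m f = (a : K) := by
  obtain ⟨g, rfl⟩ := hf
  exact ⟨coeff m g, coeff_map _ _ _⟩

variable {s : Equiv.Perm ℕ → MvPolynomial ℕ K}
  {D : Equiv.Perm ℕ → MvPolynomial ℕ K →ₗ[K] MvPolynomial ℕ K}
  {Dskew : Equiv.Perm ℕ → Equiv.Perm ℕ → MvPolynomial ℕ K →ₗ[K] MvPolynomial ℕ K}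

lemma DividedDifferenceFamily.sTr_eq_zero (hD : DividedDifferenceFamily s D)
    (hs : SchubertFamily s) {i : ℕ} {f : MvPolynomial ℕ K} (hf : rename (sTr i) f = f) :
    D (sTr i) f = 0 :=
  hD.sTr_eq_of_mul_eq hs (by rw [hf, mul_zero, sub_self])

lemma rename_sTr_prod_X (i : ℕ) (I : Finset ℕ) :
    rename (sTr i) (∏ j ∈ I, X j : MvPolynomial ℕ K) =
      ∏ j ∈ I.map (sTr i).toEmbedding, X j := by
  rw [map_prod, Finset.prod_map]
  exact Finset.prod_congr rfl fun j _ => rename_X _ _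

lemma map_sTr_eq_self {i : ℕ} {I : Finset ℕ} (h : i ∈ I ↔ i + 1 ∈ I) :
    I.map (sTr i).toEmbedding = I := by
  refine Finset.eq_of_subset_of_card_le (fun j hj => ?_) (Finset.card_map _).ge
  obtain ⟨a, ha, rfl⟩ := Finset.mem_map.mp hj
  rw [Equiv.coe_toEmbedding, sTr_apply]
  split_ifs with h1 h2
  · exact h.mp (h1 ▸ ha)
  · exact h.mpr (h2 ▸ ha)
  · exact ha

lemma DividedDifferenceFamily.sTr_prod_X (hD : DividedDifferenceFamily s D)
    (hs : SchubertFamily s) {i : ℕ} {I : Finset ℕ} (hi : i ∈ I) (hi' : i + 1 ∉ I) :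
    D (sTr i) (∏ j ∈ I, X j) = ∏ j ∈ I.erase i, X j := by
  have h : rename (sTr i) (∏ j ∈ I.erase i, X j : MvPolynomial ℕ K) = ∏ j ∈ I.erase i, X j := by
    rw [rename_sTr_prod_X, map_sTr_eq_self (by simp [hi'])]
  refine hD.sTr_eq_of_mul_eq hs ?_
  rw [← Finset.mul_prod_erase I _ hi, map_mul, h, rename_X, sTr_left]
  ring

namespace SkewFamily

/-- Positivity for squarefree monomials supported on positions of left-to-right maxima. -/
lemma prod_X_mem_of_leftToRightMax (hK : SkewFamily D Dskew)
    (hD : DividedDifferenceFamily s D) (hs : SchubertFamily s) {w : Equiv.Perm ℕ}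
    (hw : FinPerm w) {I : Finset ℕ} (hI : ∀ b ∈ I, ∀ a < b, w a < w b) (z : Equiv.Perm ℕ) :
    Dskew w z (∏ j ∈ I, X j) ∈ natPolynomials K := by
  revert I z
  refine FinPerm.descent_induction (Q := fun w => ∀ {I : Finset ℕ},
    (∀ b ∈ I, ∀ a < b, w a < w b) → ∀ z, Dskew w z (∏ j ∈ I, X j) ∈ natPolynomials K)
    (fun {I} _ z => ?_) (fun w i hw hdes ih I hI z => ?_) hw
  · rw [hK.one_apply hD hs]
    split_ifs
    · exact prod_mem fun j _ => X_mem_natPolynomials j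
    · exact zero_mem _
  have hi' : i + 1 ∉ I := fun h => (hI _ h i (Nat.lt_succ_self i)).not_gt hdes
  have hsub : ∀ J : Finset ℕ, J ⊆ I → i ∉ J → ∀ b ∈ J, ∀ a < b,
      (w * sTr i) a < (w * sTr i) b := by
    intro J hJ hiJ b hb a hab
    have hbi : b ≠ i := fun h => hiJ (h ▸ hb)
    have hbi' : b ≠ i + 1 := fun h => hi' (hJ (h ▸ hb))
    rw [Equiv.Perm.mul_apply, Equiv.Perm.mul_apply, sTr_apply i b, if_neg hbi, if_neg hbi']
    refine hI b (hJ hb) _ ?_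
    rw [sTr_apply]
    split_ifs <;> omega
  rw [hK.apply_of_descent hD hs hw hdes, rename_sTr_prod_X]
  by_cases hi : i ∈ I
  · rw [hD.sTr_prod_X hs hi hi']
    refine add_mem (ih (hsub _ (Finset.erase_subset _ _) (Finset.notMem_erase _ _)) _) ?_
    split_ifs
    · refine ih (fun b hb a hab => ?_) _
      obtain ⟨c, hc, rfl⟩ := Finset.mem_map.mp hb
      rw [Equiv.coe_toEmbedding] at hab ⊢
      have hcc : (w * sTr i) (sTr i c) = w c := by
        rw [← Equiv.Perm.mul_apply, mul_sTr_mul_sTr]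
      rw [hcc]
      have hc' : c ≠ i + 1 := fun h => hi' (h ▸ hc)
      rw [sTr_apply, if_neg hc'] at hab
      rw [Equiv.Perm.mul_apply, sTr_apply]
      by_cases hci : c = i
      · subst hci
        rw [if_pos rfl] at hab
        split_ifs with h1 h2
        · exact hdes
        · omega
        · exact hI _ hc _ (by omega)
      · rw [if_neg hci] at hab
        exact hI _ hc _ (by split_ifs <;> omega)
    · exact zero_mem _
  · have hmap := map_sTr_eq_self (i := i) (I := I) (by simp [hi, hi'])
    rw [hD.sTr_eq_zero hs (by rw [rename_sTr_prod_X, hmap]), map_zero, zero_add, hmap]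
    split_ifs
    · exact ih (hsub I subset_rfl hi) _
    · exact zero_mem _

/-- Positivity for the monomial `x_0 ⋯ x_{k-1}`. -/
lemma prod_range_X_mem (hK : SkewFamily D Dskew)
    (hD : DividedDifferenceFamily s D) (hs : SchubertFamily s) (k : ℕ) {w : Equiv.Perm ℕ}
    (hw : FinPerm w) (z : Equiv.Perm ℕ) :
    Dskew w z (∏ j ∈ Finset.range k, X j) ∈ natPolynomials K := by
  induction hl : len w using Nat.strong_induction_on generalizing w z with
  | _ l ih =>
    by_cases hdes : ∃ i, i + 1 < k ∧ w (i + 1) < w i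
    · obtain ⟨i, hik, hi⟩ := hdes
      have hmap := map_sTr_eq_self (i := i) (I := Finset.range k)
        (by simp only [Finset.mem_range]; omega)
      have hlen := len_mul_sTr_of_gt hw hi
      rw [hK.apply_of_descent hD hs hw hi,
        hD.sTr_eq_zero hs (by rw [rename_sTr_prod_X, hmap]), map_zero, zero_add,
        rename_sTr_prod_X, hmap]
      split_ifs
      · exact ih _ (by omega) (hw.mul (finPerm_sTr i)) _ rfl
      · exact zero_mem _
    · push Not at hdes
      refine hK.prod_X_mem_of_leftToRightMax hD hs hw (fun b hb => ?_) z
      rw [Finset.mem_range] at hb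
      induction b with
      | zero => intro a ha; omega
      | succ b ihb =>
        intro a ha
        have h1 := apply_lt_of_not_gt (not_lt.mpr (hdes b hb))
        rcases Nat.lt_succ_iff_lt_or_eq.mp ha with h | rfl
        · exact (ihb (by omega) a h).trans h1
        · exact h1

/-- Positivity of all `∂_{w/v} f` for fixed `v` is inherited by `∂_i f` if `v` has an ascent
at `i`. -/
lemma sTr_mem (hK : SkewFamily D Dskew) (hD : DividedDifferenceFamily s D)
    (hs : SchubertFamily s) {v : Equiv.Perm ℕ} {i : ℕ} (hv : v i < v (i + 1))
    {f : MvPolynomial ℕ K} (hf : ∀ w, FinPerm w → Dskew w v f ∈ natPolynomials K)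
    {w : Equiv.Perm ℕ} (hw : FinPerm w) : Dskew w v (D (sTr i) f) ∈ natPolynomials K := by
  by_cases hdes : w (i + 1) < w i
  · rw [hK.apply_sTr_of_descent hD hs hw hdes hv]
    exact zero_mem _
  · rw [hK.apply_sTr_of_ascent hD hs hw (apply_lt_of_not_gt hdes) hv]
    exact hf _ (hw.mul (finPerm_sTr i))

end SkewFamily

/-- The permutation obtained from `u` by raising all values by one and inserting the value `0`
at position `j`. -/
def insertZero (j : ℕ) (u : Equiv.Perm ℕ) : Equiv.Perm ℕ where
  toFun i := if i < j then u i + 1 else if i = j then 0 else u (i - 1) + 1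
  invFun m := if m = 0 then j else if u.symm (m - 1) < j then u.symm (m - 1) else u.symm (m - 1) + 1
  left_inv i := by
    rcases lt_trichotomy i j with h | rfl | h
    · simp [h]
    · simp
    · have h1 : ¬ i < j := by omega
      have h2 : i ≠ j := by omega
      have h3 : ¬ i - 1 < j := by omega
      simp only [h1, h2, h3, if_false, Nat.add_sub_cancel, Equiv.symm_apply_apply,
        Nat.add_one_ne_zero]
      omega
  right_inv m := by
    rcases Nat.eq_zero_or_pos m with rfl | h
    · simp
    · have h0 : m ≠ 0 := by omega
      by_cases h1 : u.symm (m - 1) < j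
      · simp only [h0, h1, if_false, if_true, Equiv.apply_symm_apply]
        omega
      · have h2 : ¬ u.symm (m - 1) + 1 < j := by omega
        have h3 : u.symm (m - 1) + 1 ≠ j := by omega
        simp only [h0, h1, h2, h3, if_false, Nat.add_sub_cancel, Equiv.apply_symm_apply]
        omega

lemma insertZero_apply (j : ℕ) (u : Equiv.Perm ℕ) (i : ℕ) :
    insertZero j u i = if i < j then u i + 1 else if i = j then 0 else u (i - 1) + 1 := rfl

lemma exists_eq_insertZero {k : ℕ} {u : Equiv.Perm ℕ} (hu : u k = 0) :
    ∃ u', u = insertZero k u' := by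
  have hpos : ∀ i, i ≠ k → 0 < u i := fun i hi =>
    Nat.pos_of_ne_zero fun h => hi (u.injective (h.trans hu.symm))
  have hinv : ∀ m, u.symm (m + 1) ≠ k := fun m h => by
    rw [Equiv.symm_apply_eq, hu] at h
    omega
  refine ⟨⟨fun i => if i < k then u i - 1 else u (i + 1) - 1,
    fun m => if u.symm (m + 1) < k then u.symm (m + 1) else u.symm (m + 1) - 1, fun i => ?_, fun m => ?_⟩,
    ?_⟩
  · by_cases hi : i < k
    · have := hpos i hi.ne
      simp only [hi, if_true, Nat.sub_add_cancel this, Equiv.symm_apply_apply]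
    · have := hpos (i + 1) (by omega)
      have h1 : ¬ i + 1 < k := by omega
      simp only [hi, h1, if_false, Nat.sub_add_cancel this, Equiv.symm_apply_apply,
        Nat.add_sub_cancel]
  · have h0 := hinv m
    by_cases hm : u.symm (m + 1) < k
    · simp only [hm, if_true, Equiv.apply_symm_apply, Nat.add_sub_cancel]
    · have h1 : ¬ u.symm (m + 1) - 1 < k := by omega
      have h2 : u.symm (m + 1) - 1 + 1 = u.symm (m + 1) := by omega
      simp only [hm, h1, h2, if_false, Equiv.apply_symm_apply, Nat.add_sub_cancel]
  · ext i
    rw [insertZero_apply]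
    simp only [Equiv.coe_fn_mk]
    rcases lt_trichotomy i k with h | rfl | h
    · have := hpos i h.ne
      simp only [h, if_true]
      omega
    · simp [hu]
    · have := hpos i h.ne'
      have h1 : ¬ i < k := by omega
      have h2 : i ≠ k := by omega
      have h3 : ¬ i - 1 < k := by omega
      simp only [h1, h2, h3, if_false]
      rw [show i - 1 + 1 = i by omega]
      omega

lemma InSn.of_insertZero {n k : ℕ} {u : Equiv.Perm ℕ} (hk : k ≤ n)
    (h : InSn (n + 1) (insertZero k u)) : InSn n u := fun j hj => by
  have := h (j + 1) (by omega)
  rw [insertZero_apply, if_neg (by omega), if_neg (by omega), Nat.add_sub_cancel] at this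
  omega

lemma insertZero_revPerm (n : ℕ) : insertZero n (revPerm n) = revPerm (n + 1) := by
  ext i
  rw [insertZero_apply]
  simp only [revPerm, Equiv.coe_fn_mk]
  split_ifs <;> omega

lemma insertZero_mul_sTr {n i : ℕ} (hi : i + 1 < n) (u : Equiv.Perm ℕ) :
    insertZero n (u * sTr i) = insertZero n u * sTr i := by
  ext j
  rw [Equiv.Perm.mul_apply, insertZero_apply, insertZero_apply]
  rcases lt_trichotomy j n with h | rfl | h
  · have : sTr i j < n := by rw [sTr_apply]; split_ifs <;> omega
    rw [if_pos h, if_pos this, Equiv.Perm.mul_apply]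
  · rw [inSn_sTr hi j le_rfl]
    simp
  · rw [inSn_sTr hi j h.le, if_neg (by omega), if_neg (by omega), if_neg (by omega),
      if_neg (by omega), Equiv.Perm.mul_apply, inSn_sTr hi (j - 1) (by omega)]

lemma insertZero_eq_mul_sTr (j : ℕ) (u : Equiv.Perm ℕ) :
    insertZero j u = insertZero (j + 1) u * sTr j := by
  ext i
  rw [Equiv.Perm.mul_apply, insertZero_apply, insertZero_apply, sTr_apply]
  by_cases h1 : i = j
  · subst h1; simp
  by_cases h2 : i = j + 1
  · subst h2; simp
  rw [if_neg h1, if_neg h2, if_neg h1, if_neg h2]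
  split_ifs <;> first | rfl | omega

namespace SchubertFamily

lemma insertZero_last (hs : SchubertFamily s) {n : ℕ} {u : Equiv.Perm ℕ} (hu : InSn n u) :
    s (insertZero n u) = (∏ i ∈ Finset.range n, X i) * s u := by
  refine InSn.ascent_induction
    (Q := fun u => s (insertZero n u) = (∏ i ∈ Finset.range n, X i) * s u)
    ?_ (fun w i hw hi hdes ih => ?_) hu
  · rw [insertZero_revPerm, hs.revPerm_eq, hs.revPerm_eq, Finset.prod_range_succ,
      ← Finset.prod_mul_distrib]
    simp only [Nat.add_sub_cancel, Nat.sub_self, pow_zero, mul_one]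
    refine Finset.prod_congr rfl fun i hi => ?_
    have := Finset.mem_range.mp hi
    rw [← pow_succ']
    congr 1
    omega
  · have hdes' : insertZero n w (i + 1) < insertZero n w i := by
      rw [insertZero_apply, insertZero_apply, if_pos hi, if_pos (by omega)]
      omega
    have hsymm : rename (sTr i) (∏ j ∈ Finset.range n, X j : MvPolynomial ℕ K) =
        ∏ j ∈ Finset.range n, X j := by
      rw [rename_sTr_prod_X, map_sTr_eq_self (by simp only [Finset.mem_range]; omega)]
    refine mul_left_cancel₀ (X_sub_X_succ_ne_zero (K := K) i) ?_
    rw [insertZero_mul_sTr hi, hs.descent _ i hdes', ih, map_mul, hsymm, mul_left_comm,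
      hs.descent w i hdes, mul_sub]

lemma insertZero (hs : SchubertFamily s) {n k : ℕ} {u : Equiv.Perm ℕ} (hu : InSn n u)
    (hkn : k ≤ n) (hasc : ∀ i, k ≤ i → u i ≤ u (i + 1)) :
    s (insertZero k u) = (∏ i ∈ Finset.range k, X i) * s u := by
  refine Nat.decreasingInduction' (P := fun k =>
    s (BPDPuzzle.insertZero k u) = (∏ i ∈ Finset.range k, X i) * s u)
    (fun j _ hkj ih => ?_) hkn (hs.insertZero_last hu)
  have hdes : BPDPuzzle.insertZero (j + 1) u (j + 1) < BPDPuzzle.insertZero (j + 1) u j := by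
    simp [insertZero_apply]
  have hsymm : rename (sTr j) (∏ i ∈ Finset.range j, X i : MvPolynomial ℕ K) =
      ∏ i ∈ Finset.range j, X i := by
    rw [rename_sTr_prod_X, map_sTr_eq_self (by simp)]
  refine mul_left_cancel₀ (X_sub_X_succ_ne_zero (K := K) j) ?_
  rw [insertZero_eq_mul_sTr, hs.descent _ j hdes, ih, Finset.prod_range_succ, map_mul, map_mul,
    hsymm, hs.rename_of_ascent (apply_lt_of_not_gt (not_lt.mpr (hasc j hkj))), rename_X,
    sTr_left]
  ring

end SchubertFamily

/-- Positivity of `∂_{w/v} 𝔖_u` for separated descents. -/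
theorem SkewFamily.schubert_mem (hK : SkewFamily D Dskew) (hD : DividedDifferenceFamily s D)
    (hs : SchubertFamily s) {n k : ℕ} {u v : Equiv.Perm ℕ} (hu : InSn n u)
    (hsep : SepDesc k u v) {w : Equiv.Perm ℕ} (hw : FinPerm w) :
    Dskew w v (s u) ∈ natPolynomials K := by
  induction n generalizing k u w with
  | zero =>
    have : u = 1 := Equiv.ext fun j => hu j (Nat.zero_le j)
    rw [this, hs.one, hK.apply_one hD hs hw]
    split_ifs
    · exact one_mem _
    · exact zero_mem _
  | succ n ihn =>
    obtain ⟨l, hl⟩ : ∃ l, u l = 0 := u.surjective 0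
    have hlk : l ≤ k := by
      by_contra! hc
      have := apply_lt_of_not_gt (not_lt.mpr (hsep.1 (l - 1) (by omega)))
      rw [show l - 1 + 1 = l by omega, hl] at this
      omega
    obtain ⟨d, rfl⟩ := Nat.exists_eq_add_of_le hlk
    clear hlk
    induction d generalizing u w l with
    | zero =>
      rw [add_zero] at hsep
      have hln : l ≤ n := by
        by_contra! hc
        have := hu l hc
        omega
      obtain ⟨u', rfl⟩ := exists_eq_insertZero hl
      have hu' := hu.of_insertZero hln
      have hasc : ∀ i, l ≤ i → u' i ≤ u' (i + 1) := fun i hi => by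
        have := hsep.1 (i + 1) (by omega)
        rw [insertZero_apply, insertZero_apply, if_neg (by omega), if_neg (by omega),
          if_neg (by omega), if_neg (by omega)] at this
        simpa using this
      rw [hs.insertZero hu' hln hasc, hK.apply_mul hD hs hw]
      refine sum_mem fun z hz => mul_mem (hK.prod_range_X_mem hD hs l hw z) ?_
      have hzf : FinPerm z := by
        by_contra hc
        exact Finsupp.mem_support_iff.mp hz (hK.coeffs_apply_of_not_finPerm w hc _)
      exact ihn hu' ⟨hasc, hsep.2⟩ hzf
    | succ d ihd =>
      by_cases hdes : u (l + d + 1) < u (l + d)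
      · have hd : d ≠ 0 := by
          rintro rfl
          simp [hl] at hdes
        have hln : l + d + 1 < n + 1 := by
          have := hu.invSet_subset (show (l + d, l + d + 1) ∈ invSet u from
            ⟨Nat.lt_succ_self _, hdes⟩)
          simp only [Finset.coe_product, Finset.coe_range, Set.mem_prod, Set.mem_Iio] at this
          exact this.2
        have hsl : l + 1 < n + 1 := by omega
        have hul : u l < u (l + 1) :=
          apply_lt_of_not_gt (by rw [hl]; exact Nat.not_lt_zero _)
        have h := hD.sTr_apply_of_descent (hu.finPerm.mul (finPerm_sTr l)) (i := l)
          (by simpa using hul)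
        rw [mul_sTr_mul_sTr] at h
        rw [← h]
        refine hK.sTr_mem hD hs (apply_lt_of_not_gt (not_lt.mpr (hsep.2 l (by omega))))
          (fun w hw => ihd (hu.mul (inSn_sTr hsl)) hw (l + 1) (by simpa using hl)
            ⟨fun i hi => ?_, fun i hi => ?_⟩) hw
        · rw [Equiv.Perm.mul_apply, Equiv.Perm.mul_apply, sTr_apply, sTr_apply,
            if_neg (by omega), if_neg (by omega), if_neg (by omega), if_neg (by omega)]
          exact hsep.1 i (by omega)
        · exact hsep.2 i (by omega)
      · refine ihd hu hw l hl ⟨fun i hi => ?_, fun i hi => hsep.2 i (by omega)⟩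
        rcases hi.eq_or_lt with rfl | hi
        · exact not_lt.mp hdes
        · exact hsep.1 i (by omega)

end Positivity

/-- Kirillov's conjecture holds for permutations with separated
descents.  If `u, v ∈ S_n` have separated descents at some position `k`, then
for every permutation `w` the polynomial `∂_{w/v} 𝔖_u(x)` has nonnegative
integer coefficients.

Here `S` is the family of double Schubert polynomials (`β = 0` Grothendieck
polynomials), so `S (fun _ => 0) u` is the single Schubert polynomial `𝔖_u(x)`;
`D w` is the divided difference operator `∂_w` and `Dskew w v` the skew divided
difference operator `∂_{w/v}`, characterized by
`∂_w(fg) = Σ_v (∂_{w/v} f)·(∂_v g)`. -/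
theorem kirillov_conjecture_separated_descents
    {K : Type*} [Field K] [CharZero K]
    (S : (ℕ → K) → Equiv.Perm ℕ → MvPolynomial ℕ K)
    (hS : GrothFamily (0 : K) S)
    (D : Equiv.Perm ℕ → MvPolynomial ℕ K →ₗ[K] MvPolynomial ℕ K)
    (hD : ∀ (t : ℕ → K) (u w : Equiv.Perm ℕ), FinPerm u → FinPerm w →
      D w (S t u) = if len (u * w⁻¹) + len w = len u then S t (u * w⁻¹) else 0)
    (Dskew : Equiv.Perm ℕ → Equiv.Perm ℕ → MvPolynomial ℕ K →ₗ[K] MvPolynomial ℕ K)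
    (hskewsupp : ∀ w v, ¬ FinPerm v → Dskew w v = 0)
    (hskewfin : ∀ (w : Equiv.Perm ℕ) (f : MvPolynomial ℕ K),
      {v : Equiv.Perm ℕ | Dskew w v f ≠ 0}.Finite)
    (hLeib : ∀ (w : Equiv.Perm ℕ), FinPerm w → ∀ f g : MvPolynomial ℕ K,
      D w (f * g) = ∑ᶠ v : Equiv.Perm ℕ, Dskew w v f * D v g)
    (n k : ℕ) (hk : k ≤ n)
    (u v : Equiv.Perm ℕ) (hu : InSn n u) (hv : InSn n v)
    (hsep : SepDesc k u v)
    (w : Equiv.Perm ℕ) (hw : FinPerm w) :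
    ∀ m : ℕ →₀ ℕ, ∃ a : ℕ,
      MvPolynomial.coeff m (Dskew w v (S (fun _ => 0) u)) = (a : K) := by
  have hs := hS.schubertFamily
  have hDD : DividedDifferenceFamily (S fun _ => 0) D := fun u w hu hw => hD _ u w hu hw
  have hK : SkewFamily D Dskew := ⟨hskewsupp, hskewfin, hLeib⟩
  exact exists_coeff_eq_of_mem_natPolynomials (hK.schubert_mem hDD hs hu hsep hw)
end BPDPuzzle
end
end

section
/- Bumpless pipe dream formula (Weigandt's model recovered): let k=n, so every u ∈ S_n has separated descents at n with v=id. Then 𝔊_u(t,y) = Σ_{π∈PP(u,id,id)} wt(π), i.e. the double Grothendieck polynomial of u (in variables t and y) equals the weighted sum over all pipe puzzles for (u,id,id); moreover, reflecting these pipe puzzles across the main diagonal identifies PP(u,id,id) with the set of bumpless pipe dreams of u. -/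
open MvPolynomial

noncomputable section

namespace BPDPuzzle

/-- Reflection of a lattice state across the main diagonal. -/
def reflectState (n : ℕ) (sst : GridState n) : GridState n :=
  (fun i j => sst.2 j i, fun i j => sst.1 j i)


/-! ### Transfer operators of the lattice model

Columns are read from right to left, so that lists of column labels and column
parameters start with the rightmost column. -/

section Transfer

variable {R : Type*} [CommRing R]

/-- Expectation of `f W S` over the tiles with north label `N` and east label `E`. -/
def tileSum (β x : R) (f : ℕ → ℕ → R) (N E : ℕ) : R :=
  if N = 0 then (if E = 0 then x * f 0 0 else f E 0 + f 0 E)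
  else if E = 0 then f 0 N + (1 + β * x) * f N 0
  else if E < N then f E N + β * f N E else 0

/-- Weighted sum of `F` over all row configurations with given column parameters, north
labels and right boundary label, the left boundary label being `0`. -/
def rowSum (β z : R) : List R → List ℕ → ℕ → (List ℕ → R) → R
  | [], [], h, F => if h = 0 then F [] else 0
  | t :: ts, N :: vs, h, F =>
      tileSum β (t + z + β * t * z) (fun W S => rowSum β z ts vs W (fun l => F (S :: l))) N h
  | [], _ :: _, _, _ => 0
  | _ :: _, [], _, _ => 0

/-- Weighted sum of `F` over all configurations of a grid whose rows, from top to bottom,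
carry the given parameters and right boundary labels. -/
def gridSum (β : R) (ts : List R) : List (R × ℕ) → List ℕ → (List ℕ → R) → R
  | [], vs, F => F vs
  | p :: rows, vs, F => rowSum β p.1 ts vs p.2 (fun l => gridSum β ts rows l F)

theorem tileSum_zero (β x : R) (N E : ℕ) : tileSum β x (fun _ _ => 0) N E = 0 := by
  simp [tileSum]

theorem rowSum_zero (β z : R) (ts : List R) (vs : List ℕ) (h : ℕ) :
    rowSum β z ts vs h (fun _ => 0) = 0 := by
  induction ts generalizing vs h with
  | nil => cases vs <;> simp [rowSum]
  | cons t ts ih => cases vs <;> simp [rowSum, ih, tileSum_zero]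

theorem rowSum_linear (β z c d : R) (ts : List R) (vs : List ℕ) (h : ℕ)
    (F G : List ℕ → R) :
    rowSum β z ts vs h (fun l => c * F l + d * G l) =
      c * rowSum β z ts vs h F + d * rowSum β z ts vs h G := by
  induction ts generalizing vs h F G with
  | nil =>
    cases vs
    · simp only [rowSum]
      split_ifs <;> ring
    · simp [rowSum]
  | cons t ts ih =>
    cases vs
    · simp [rowSum]
    · simp only [rowSum, ih, tileSum]
      split_ifs <;> ring

theorem map_tileSum {S : Type*} [CommRing S] (φ : R →+* S) (β x : R) (f : ℕ → ℕ → R)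
    (N E : ℕ) :
    φ (tileSum β x f N E) = tileSum (φ β) (φ x) (fun W S => φ (f W S)) N E := by
  unfold tileSum
  split_ifs <;> simp

theorem map_rowSum {S : Type*} [CommRing S] (φ : R →+* S) (β z : R) (ts : List R)
    (vs : List ℕ) (h : ℕ) (F : List ℕ → R) :
    φ (rowSum β z ts vs h F) = rowSum (φ β) (φ z) (ts.map φ) vs h (fun l => φ (F l)) := by
  induction ts generalizing vs h F with
  | nil => cases vs <;> simp [rowSum, apply_ite φ]
  | cons t ts ih => cases vs <;> simp [rowSum, ih, map_tileSum]

theorem map_gridSum {S : Type*} [CommRing S] (φ : R →+* S) (β : R) (ts : List R)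
    (rows : List (R × ℕ)) (vs : List ℕ) (F : List ℕ → R) :
    φ (gridSum β ts rows vs F) =
      gridSum (φ β) (ts.map φ) (rows.map (Prod.map φ id)) vs (fun l => φ (F l)) := by
  induction rows generalizing vs with
  | nil => rfl
  | cons p rows ih => simp [gridSum, ih, map_rowSum]

/-! ### The Yang–Baxter equation for adjacent columns -/

/-- Diagonal entry of the `R`-matrix. -/
def diagCoeff (β a b : R) (x y : ℕ) : R :=
  if x = 0 ∨ (y ≠ 0 ∧ y ≤ x) then 1 + β * b else 1 + β * a

/-- Off-diagonal entry of the `R`-matrix. -/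
def swapCoeff (a b : R) (x y : ℕ) : R := if x < y then a - b else 0

/-- The `R`-matrix acting on the columns `k` and `k+1` (counted from the right). -/
def rMatrix (β a b : R) : ℕ → (List ℕ → R) → List ℕ → R
  | 0, F, x :: y :: l =>
      diagCoeff β a b x y * F (x :: y :: l) + swapCoeff a b x y * F (y :: x :: l)
  | k + 1, F, x :: l => rMatrix β a b k (fun l => F (x :: l)) l
  | _, _, _ => 0

theorem rMatrix_append (β a b : R) (P Q : List ℕ) (x y : ℕ) (F : List ℕ → R) :
    rMatrix β a b P.length F (P ++ x :: y :: Q) =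
      diagCoeff β a b x y * F (P ++ x :: y :: Q) +
        swapCoeff a b x y * F (P ++ y :: x :: Q) := by
  induction P generalizing F with
  | nil => rfl
  | cons p P ih => simp [rMatrix, ih]

theorem rMatrix_zero (β a b : R) (k : ℕ) (l : List ℕ) :
    rMatrix β a b k (fun _ => 0) l = 0 := by
  induction k generalizing l with
  | zero => rcases l with _ | ⟨x, _ | ⟨y, l⟩⟩ <;> simp [rMatrix]
  | succ k ih => cases l <;> simp [rMatrix, ih]

theorem rMatrix_add (β a b : R) (k : ℕ) (F G : List ℕ → R) (l : List ℕ) :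
    rMatrix β a b k (fun l => F l + G l) l = rMatrix β a b k F l + rMatrix β a b k G l := by
  induction k generalizing F G l with
  | zero =>
    rcases l with _ | ⟨x, _ | ⟨y, l⟩⟩ <;> simp only [rMatrix, add_zero]
    ring
  | succ k ih => cases l <;> simp [rMatrix, ih]

theorem rMatrix_mul (β a b c : R) (k : ℕ) (F : List ℕ → R) (l : List ℕ) :
    rMatrix β a b k (fun l => c * F l) l = c * rMatrix β a b k F l := by
  induction k generalizing F l with
  | zero =>
    rcases l with _ | ⟨x, _ | ⟨y, l⟩⟩ <;> simp only [rMatrix, mul_zero]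
    ring
  | succ k ih => cases l <;> simp [rMatrix, ih]

theorem rMatrix_tileSum (β a b : R) (k : ℕ) (x : R) (f : ℕ → ℕ → List ℕ → R) (N E : ℕ)
    (l : List ℕ) :
    rMatrix β a b k (fun l => tileSum β x (fun W S => f W S l) N E) l =
      tileSum β x (fun W S => rMatrix β a b k (f W S) l) N E := by
  unfold tileSum
  split_ifs <;> simp only [rMatrix_add, rMatrix_mul, rMatrix_zero]

theorem tileSum_yangBaxter (β a b z : R) (f : ℕ → ℕ → ℕ → R) (x y h : ℕ) :
    tileSum β (a + z + β * a * z) (fun W S₁ => tileSum β (b + z + β * b * z)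
      (fun W' S₂ => diagCoeff β a b S₁ S₂ * f W' S₁ S₂ + swapCoeff a b S₁ S₂ * f W' S₂ S₁)
        y W) x h =
    diagCoeff β a b x y * tileSum β (b + z + β * b * z) (fun W S₁ =>
        tileSum β (a + z + β * a * z) (fun W' S₂ => f W' S₁ S₂) y W) x h +
      swapCoeff a b x y * tileSum β (b + z + β * b * z) (fun W S₁ =>
        tileSum β (a + z + β * a * z) (fun W' S₂ => f W' S₁ S₂) x W) y h := by
  have key : ∀ p q : ℕ, p < q → ¬ q < p ∧ ¬ q ≤ p ∧ p ≤ q ∧ p ≠ q ∧ q ≠ p := by omega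
  have pos : ∀ p : ℕ, 0 < p → p ≠ 0 := by omega
  unfold tileSum diagCoeff swapCoeff
  rcases Nat.eq_zero_or_pos x with rfl | hx <;> rcases Nat.eq_zero_or_pos y with rfl | hy <;>
    rcases Nat.eq_zero_or_pos h with rfl | hh
  case inr.inr.inr =>
    rcases lt_trichotomy x y with hxy | rfl | hxy
    · rcases lt_trichotomy x h with hxh | rfl | hxh
      · rcases lt_trichotomy y h with hyh | rfl | hyh <;> simp [*]
      · simp [*]
      · have hyh := hxh.trans hxy
        simp [*]
        ring
    · rcases lt_trichotomy x h with hxh | rfl | hxh <;> simp [*] <;> try ring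
    · rcases lt_trichotomy x h with hxh | rfl | hxh
      · have hyh := hxy.trans hxh
        simp [*]
      · simp [*]
      · rcases lt_trichotomy y h with hyh | rfl | hyh <;> simp [*] <;> try ring
  case inl.inr.inr =>
    rcases lt_trichotomy y h with hyh | rfl | hyh <;> simp [*] <;> ring
  case inr.inl.inr =>
    rcases lt_trichotomy x h with hxh | rfl | hxh <;> simp [*] <;> try ring
  case inr.inr.inl =>
    rcases lt_trichotomy x y with hxy | rfl | hxy <;> simp [*] <;> ring
  all_goals simp [*]
  all_goals try ring

theorem rowSum_yangBaxter (β z a b : R) (A B : List R) (vs : List ℕ) (h : ℕ)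
    (F : List ℕ → R) :
    rowSum β z (A ++ a :: b :: B) vs h (rMatrix β a b A.length F) =
      rMatrix β a b A.length (fun vs => rowSum β z (A ++ b :: a :: B) vs h F) vs := by
  induction A generalizing vs h F with
  | nil =>
    rcases vs with _ | ⟨x, _ | ⟨y, vs⟩⟩
    · simp [rowSum, rMatrix]
    · simp [rowSum, rMatrix, tileSum_zero]
    · simp only [List.nil_append, List.length_nil, rowSum, rMatrix]
      rw [← tileSum_yangBaxter β a b z
        (fun W S₁ S₂ => rowSum β z B vs W (fun l => F (S₁ :: S₂ :: l)))]
      simp only [rowSum_linear]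
  | cons t A ih =>
    cases vs with
    | nil => simp [rowSum, rMatrix]
    | cons x vs =>
      simp only [List.cons_append, List.length_cons, rowSum, rMatrix, ih]
      rw [rMatrix_tileSum]

theorem gridSum_yangBaxter (β a b : R) (A B : List R) (rows : List (R × ℕ))
    (vs : List ℕ) (F : List ℕ → R) :
    gridSum β (A ++ a :: b :: B) rows vs (rMatrix β a b A.length F) =
      rMatrix β a b A.length (fun vs => gridSum β (A ++ b :: a :: B) rows vs F) vs := by
  induction rows generalizing vs with
  | nil => rfl
  | cons p rows ih =>
    simp only [gridSum, ih]
    exact rowSum_yangBaxter β p.1 a b A B vs p.2 _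

end Transfer

/-! ### Exchanging two adjacent pipe labels -/

section Exchange

variable {R : Type*} [CommRing R]

/-- The subword of the labels `c` and `c + 1`. -/
def pairWord (c : ℕ) (l : List ℕ) : List ℕ := l.filter (fun x => x = c ∨ x = c + 1)

theorem pairWord_append (c : ℕ) (l l' : List ℕ) :
    pairWord c (l ++ l') = pairWord c l ++ pairWord c l' := by
  simp [pairWord]

theorem pairWord_swap_cons (c : ℕ) {h N : ℕ} (h₁ : ¬ (h = c ∧ N = c + 1))
    (h₂ : ¬ (h = c + 1 ∧ N = c)) (l l' : List ℕ) :
    pairWord c (l ++ N :: h :: l') = pairWord c (l ++ h :: N :: l') := by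
  by_cases hh : h = c ∨ h = c + 1 <;> by_cases hN : N = c ∨ N = c + 1
  · have : h = N := by omega
    rw [this]
  all_goals simp [pairWord, hh, hN]

theorem map_swap_of_pairWord_eq_nil {c : ℕ} {l : List ℕ} (h : pairWord c l = []) :
    l.map (Equiv.swap c (c + 1)) = l := by
  simp only [pairWord, List.filter_eq_nil_iff, decide_eq_true_eq, not_or] at h
  conv_rhs => rw [← List.map_id l]
  exact List.map_congr_left fun x hx => Equiv.swap_apply_of_ne_of_ne (h x hx).1 (h x hx).2

theorem pairWord_map_swap (c : ℕ) (l : List ℕ) :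
    pairWord c (l.map (Equiv.swap c (c + 1))) =
      (pairWord c l).map (Equiv.swap c (c + 1)) := by
  have : ∀ x, (Equiv.swap c (c + 1) x = c ∨ Equiv.swap c (c + 1) x = c + 1) ↔
      (x = c ∨ x = c + 1) := by
    intro x
    rw [Equiv.swap_apply_def]
    split_ifs <;> omega
  simp only [pairWord, List.filter_map, Function.comp_def, this]

theorem pairWord_pair_of_eq {c h N : ℕ} {l l' : List ℕ}
    (hc : (h = c ∧ N = c + 1) ∨ (h = c + 1 ∧ N = c)) {L : List ℕ} (hL : L.length = 2)
    (hw : pairWord c (l ++ h :: N :: l') = L) :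
    pairWord c l = [] ∧ pairWord c l' = [] ∧ L = [h, N] := by
  have hh : h = c ∨ h = c + 1 := by omega
  have hN : N = c ∨ N = c + 1 := by omega
  rw [pairWord_append] at hw
  have e : pairWord c (h :: N :: l') = h :: N :: pairWord c l' := by simp [pairWord, hh, hN]
  rw [e] at hw
  have hlen := congrArg List.length hw
  simp only [List.length_append, List.length_cons, hL] at hlen
  have h1 : pairWord c l = [] := List.length_eq_zero_iff.mp (by omega)
  have h2 : pairWord c l' = [] := List.length_eq_zero_iff.mp (by omega)
  refine ⟨h1, h2, ?_⟩
  rw [← hw, h1, h2]; rfl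

theorem tileSum_exchange (β x : R) {c : ℕ} (hc : 0 < c) (f f₁ f₂ : ℕ → ℕ → R) (N h : ℕ)
    (l l' : List ℕ)
    (hf : ∀ W S, pairWord c (l ++ S :: W :: l') = [c, c + 1] →
      f W S = f₁ (Equiv.swap c (c + 1) W) (Equiv.swap c (c + 1) S) + β * f₂ W S)
    (hf' : ∀ W S, pairWord c (l ++ S :: W :: l') = [c + 1, c] → f W S = 0)
    (hE : pairWord c l = [] → pairWord c l' = [] → f₁ = f₂)
    (hw : pairWord c (l ++ h :: N :: l') = [c, c + 1]) :
    tileSum β x f N h =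
      tileSum β x f₁ (Equiv.swap c (c + 1) N) (Equiv.swap c (c + 1) h) +
        β * tileSum β x f₂ N h := by
  by_cases h₂ : h = c + 1 ∧ N = c
  · have := (pairWord_pair_of_eq (Or.inr h₂) rfl hw).2.2
    simp at this
    omega
  by_cases h₁ : h = c ∧ N = c + 1
  · obtain ⟨e1, e2, -⟩ := pairWord_pair_of_eq (Or.inl h₁) rfl hw
    obtain ⟨rfl, rfl⟩ := h₁
    have e := hE e1 e2
    subst e
    have z : f h (h + 1) = 0 := hf' _ _ (by
      rw [pairWord_append, e1]
      have := e2
      simp [pairWord] at this ⊢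
      exact this)
    have z' := hf _ _ hw
    simp only [Equiv.swap_apply_left, Equiv.swap_apply_right] at z' ⊢
    simp [tileSum, z, z', hc.ne', mul_add]
  · have hsw := pairWord_swap_cons c h₁ h₂ l l'
    have a1 := hf N h hw
    have a2 := hf h N (hsw.trans hw)
    have s0 : Equiv.swap c (c + 1) 0 = 0 :=
      Equiv.swap_apply_of_ne_of_ne (by omega) (by omega)
    have sz : ∀ m, Equiv.swap c (c + 1) m = 0 ↔ m = 0 := fun m => by
      rw [← s0, EmbeddingLike.apply_eq_iff_eq, s0]
    have sl : Equiv.swap c (c + 1) h < Equiv.swap c (c + 1) N ↔ h < N := by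
      simp only [Equiv.swap_apply_def]
      split_ifs <;> omega
    unfold tileSum
    simp only [sz, sl]
    by_cases hN : N = 0 <;> by_cases hh : h = 0
    · subst hN hh
      simp only [s0] at a1
      simp [a1]; ring
    · subst hN
      simp only [s0] at a1 a2
      simp [hh, a1, a2]; ring
    · subst hh
      simp only [s0] at a1 a2
      simp [hN, a1, a2]; ring
    · simp only [hN, hh, if_false]
      split_ifs
      · rw [a1, a2]; ring
      · ring

theorem tileSum_eq_zero_of_pairWord (β x : R) {c : ℕ} (hc : 0 < c) (f : ℕ → ℕ → R)
    (N h : ℕ) (l l' : List ℕ)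
    (hf' : ∀ W S, pairWord c (l ++ S :: W :: l') = [c + 1, c] → f W S = 0)
    (hw : pairWord c (l ++ h :: N :: l') = [c + 1, c]) :
    tileSum β x f N h = 0 := by
  by_cases h₁ : h = c ∧ N = c + 1
  · have := (pairWord_pair_of_eq (Or.inl h₁) rfl hw).2.2
    simp at this
    omega
  by_cases h₂ : h = c + 1 ∧ N = c
  · obtain ⟨rfl, rfl⟩ := h₂
    simp [tileSum, hc.ne']
  · have hsw := pairWord_swap_cons c h₁ h₂ l l'
    have a1 := hf' N h hw
    have a2 := hf' h N (hsw.trans hw)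
    unfold tileSum
    by_cases hN : N = 0 <;> by_cases hh : h = 0
    · subst hN hh
      simp [a1]
    · subst hN
      simp [hh, a1, a2]
    · subst hh
      simp [hN, a1, a2]
    · simp [hN, hh, a1, a2]

theorem rowSum_exchange (β z : R) {c : ℕ} (hc : 0 < c) (ts : List R) (vs : List ℕ) (h : ℕ)
    (F F₁ F₂ : List ℕ → R) (l : List ℕ)
    (hF : ∀ v, pairWord c (l ++ v) = [c, c + 1] →
      F v = F₁ (v.map (Equiv.swap c (c + 1))) + β * F₂ v)
    (hF' : ∀ v, pairWord c (l ++ v) = [c + 1, c] → F v = 0)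
    (hE : pairWord c l = [] → F₁ = F₂) :
    (pairWord c (l ++ h :: vs) = [c, c + 1] →
      rowSum β z ts vs h F =
        rowSum β z ts (vs.map (Equiv.swap c (c + 1))) (Equiv.swap c (c + 1) h) F₁ +
          β * rowSum β z ts vs h F₂) ∧
    (pairWord c (l ++ h :: vs) = [c + 1, c] → rowSum β z ts vs h F = 0) := by
  have s0 : Equiv.swap c (c + 1) 0 = 0 :=
    Equiv.swap_apply_of_ne_of_ne (by omega) (by omega)
  have sz : ∀ m, Equiv.swap c (c + 1) m = 0 ↔ m = 0 := fun m => by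
    rw [← s0, EmbeddingLike.apply_eq_iff_eq, s0]
  induction ts generalizing vs h F F₁ F₂ l with
  | nil =>
    cases vs with
    | nil =>
      by_cases hh : h = 0
      · subst hh
        have e : pairWord c (l ++ [0]) = pairWord c (l ++ []) := by
          simp [pairWord]
          omega
        rw [e]
        constructor
        · intro hw
          simpa [rowSum, s0] using hF [] hw
        · intro hw
          simpa [rowSum] using hF' [] hw
      · simp [rowSum, sz, hh]
    | cons N vs => simp [rowSum]
  | cons t ts ih =>
    cases vs with
    | nil => simp [rowSum]
    | cons N vs =>
      have key := fun W S => ih vs W (fun v => F (S :: v))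
        (fun v => F₁ (Equiv.swap c (c + 1) S :: v)) (fun v => F₂ (S :: v)) (l ++ [S])
        (fun v hv => by
          rw [List.append_assoc] at hv
          simpa using hF (S :: v) hv)
        (fun v hv => by
          rw [List.append_assoc] at hv
          simpa using hF' (S :: v) hv)
        (fun hl => by
          rw [pairWord_append, List.append_eq_nil_iff] at hl
          have := map_swap_of_pairWord_eq_nil hl.2
          simp only [List.map_cons, List.map_nil, List.cons.injEq, and_true] at this
          rw [this, hE hl.1])
      simp only [List.append_assoc, List.cons_append, List.nil_append] at key
      refine ⟨fun hw => ?_, fun hw => ?_⟩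
      · simp only [rowSum, List.map_cons]
        exact tileSum_exchange β _ hc _
          (fun W S => rowSum β z ts (vs.map (Equiv.swap c (c + 1))) W (fun v => F₁ (S :: v)))
          (fun W S => rowSum β z ts vs W (fun v => F₂ (S :: v))) N h l vs
          (fun W S => (key W S).1) (fun W S => (key W S).2)
          (fun h1 h2 => by rw [map_swap_of_pairWord_eq_nil h2, hE h1]) hw
      · simp only [rowSum]
        exact tileSum_eq_zero_of_pairWord β _ hc _ N h l vs (fun W S => (key W S).2) hw

theorem gridSum_exchange (β : R) {c : ℕ} (hc : 0 < c) (ts : List R) (rows : List (R × ℕ))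
    (vs : List ℕ) (F D : List ℕ → R)
    (hF : ∀ v, pairWord c v = [c, c + 1] →
      F v = D (v.map (Equiv.swap c (c + 1))) + β * D v)
    (hF' : ∀ v, pairWord c v = [c + 1, c] → F v = 0) :
    (pairWord c ((rows.map Prod.snd).reverse ++ vs) = [c, c + 1] →
      gridSum β ts rows vs F =
        gridSum β ts (rows.map (Prod.map id (Equiv.swap c (c + 1))))
          (vs.map (Equiv.swap c (c + 1))) D + β * gridSum β ts rows vs D) ∧
    (pairWord c ((rows.map Prod.snd).reverse ++ vs) = [c + 1, c] →
      gridSum β ts rows vs F = 0) := by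
  induction rows generalizing vs with
  | nil => exact ⟨by simpa [gridSum] using hF vs, by simpa [gridSum] using hF' vs⟩
  | cons p rows ih =>
    have key := rowSum_exchange β p.1 hc ts vs p.2 (fun l => gridSum β ts rows l F)
      (fun l => gridSum β ts (rows.map (Prod.map id (Equiv.swap c (c + 1)))) l D)
      (fun l => gridSum β ts rows l D) (rows.map Prod.snd).reverse
      (fun v hv => (ih v).1 hv) (fun v hv => (ih v).2 hv)
      (fun hl => by
        have hl' : pairWord c (rows.map Prod.snd) = [] := by
          simpa [pairWord] using hl
        have e : rows.map (Prod.map id (Equiv.swap c (c + 1))) = rows := by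
          conv_rhs => rw [← List.map_id rows]
          refine List.map_congr_left fun q hq => ?_
          have := map_swap_of_pairWord_eq_nil hl'
          rw [List.map_map] at this
          have := List.map_inj_left.mp this q hq
          exact Prod.ext rfl this
        rw [e])
    simpa [gridSum] using key

end Exchange

/-! ### The longest permutation -/

section Longest

/-- The list `[f (n-1), …, f 1, f 0]`. -/
def downList {α : Type*} (f : ℕ → α) : ℕ → List α
  | 0 => []
  | n + 1 => f n :: downList f n

theorem map_downList {α α' : Type*} (g : α → α') (f : ℕ → α) (n : ℕ) :
    (downList f n).map g = downList (fun j => g (f j)) n := by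
  induction n with
  | zero => rfl
  | succ n ih => simp [downList, ih]

theorem length_downList {α : Type*} (f : ℕ → α) (n : ℕ) : (downList f n).length = n := by
  induction n with
  | zero => rfl
  | succ n ih => simp [downList, ih]

theorem mem_downList {α : Type*} {f : ℕ → α} {n : ℕ} {a : α} :
    a ∈ downList f n ↔ ∃ j < n, f j = a := by
  induction n with
  | zero => simp [downList]
  | succ n ih =>
    simp only [downList, List.mem_cons, ih, Nat.lt_succ_iff_lt_or_eq]
    constructor
    · rintro (rfl | ⟨j, hj, rfl⟩)
      exacts [⟨n, Or.inr rfl, rfl⟩, ⟨j, Or.inl hj, rfl⟩]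
    · rintro ⟨j, hj | rfl, rfl⟩
      exacts [Or.inr ⟨j, hj, rfl⟩, Or.inl rfl]

theorem downList_congr {α : Type*} {f g : ℕ → α} {n : ℕ} (h : ∀ j < n, f j = g j) :
    downList f n = downList g n := by
  induction n with
  | zero => rfl
  | succ n ih => rw [downList, downList, h n (by omega), ih fun j hj => h j (by omega)]

theorem downList_add {α : Type*} (f : ℕ → α) (i m : ℕ) :
    downList f (i + m) = downList (fun j => f (i + j)) m ++ downList f i := by
  induction m with
  | zero => rfl
  | succ m ih => rw [← Nat.add_assoc, downList, ih]; rfl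

theorem reverse_map_range {α : Type*} (f : ℕ → α) (n : ℕ) :
    ((List.range n).map f).reverse = downList f n := by
  induction n with
  | zero => rfl
  | succ n ih => simp [List.range_succ, downList, ← ih]

theorem map_range_eq_downList {α : Type*} (f : ℕ → α) (n : ℕ) :
    (List.range n).map f = downList (fun j => f (n - 1 - j)) n := by
  rw [← reverse_map_range]
  refine List.ext_getElem (by simp) fun j h₁ h₂ => ?_
  simp only [List.length_map, List.length_range] at h₁
  simp only [List.getElem_map, List.getElem_range, List.getElem_reverse, List.length_map,
    List.length_range]
  congr 1
  omega

variable {R : Type*} [CommRing R]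

theorem prod_downList (f : ℕ → R) (n : ℕ) :
    (downList f n).prod = ∏ i ∈ Finset.range n, f i := by
  induction n with
  | zero => rfl
  | succ n ih => rw [downList, List.prod_cons, ih, Finset.prod_range_succ, mul_comm]

/-- The indicator function of a word. -/
def wordDelta (w v : List ℕ) : R := if v = w then 1 else 0

theorem tileSum_eq_zero {β x : R} {f : ℕ → ℕ → R} {N E : ℕ} (P : ℕ → Prop) (h0 : P 0)
    (hN : P N) (hE : P E) (hf : ∀ W S, P W → P S → f W S = 0) : tileSum β x f N E = 0 := by
  simp [tileSum, hf, h0, hN, hE]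

theorem rowSum_eq_zero_of_notMem_take (β z : R) {L : ℕ} (hL : L ≠ 0) (ts : List R)
    (vs : List ℕ) (h p : ℕ) (F : List ℕ → R) (hF : ∀ l, L ∉ l.take p → F l = 0)
    (hh : h ≠ L) (hvs : L ∉ vs.take p) : rowSum β z ts vs h F = 0 := by
  induction ts generalizing vs h p F with
  | nil => cases vs <;> simp [rowSum, hF [] (by simp)]
  | cons t ts ih =>
    cases vs with
    | nil => rfl
    | cons N vs =>
      cases p with
      | zero =>
        have : F = fun _ => 0 := funext fun l => hF l (by simp)
        rw [this, rowSum_zero]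
      | succ p =>
        simp only [List.take_succ_cons, List.mem_cons, not_or] at hvs
        refine tileSum_eq_zero (· ≠ L) hL.symm (Ne.symm hvs.1) hh fun W S hW hS => ?_
        refine ih vs W p _ (fun l hl => hF _ ?_) hW hvs.2
        simp [hl, Ne.symm hS]

theorem gridSum_eq_zero_of_notMem_take (β : R) {L : ℕ} (hL : L ≠ 0) (ts : List R)
    (rows : List (R × ℕ)) (vs : List ℕ) (p : ℕ) (F : List ℕ → R)
    (hF : ∀ l, L ∉ l.take p → F l = 0) (hrows : L ∉ rows.map Prod.snd)
    (hvs : L ∉ vs.take p) : gridSum β ts rows vs F = 0 := by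
  induction rows generalizing vs with
  | nil => exact hF vs hvs
  | cons q rows ih =>
    simp only [List.map_cons, List.mem_cons, not_or] at hrows
    exact rowSum_eq_zero_of_notMem_take β q.1 hL ts vs q.2 p _ (fun l hl => ih l hrows.2 hl)
      (Ne.symm hrows.1) hvs

theorem exists_notMem_take_of_not_isPrefix_word {B l : List ℕ} (hB : B.Nodup) (h : ¬ B <+: l) :
    ∃ p, ∃ L ∈ B.take p, L ∉ l.take p := by
  induction B generalizing l with
  | nil => simp at h
  | cons b B ih =>
    cases l with
    | nil => exact ⟨1, b, by simp, by simp⟩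
    | cons x l =>
      by_cases hx : b = x
      · subst hx
        rw [List.nodup_cons] at hB
        obtain ⟨p, L, h1, h2⟩ := ih hB.2 (l := l) (by simpa using h)
        have : L ≠ b := by
          rintro rfl
          exact hB.1 (List.mem_of_mem_take h1)
        exact ⟨p + 1, L, by simp [h1], by simp [h2, this]⟩
      · exact ⟨1, b, by simp, by simp [hx]⟩

theorem gridSum_eq_zero_of_not_isPrefix_word (β : R) (ts : List R) (rows : List (R × ℕ))
    (l B C : List ℕ) (hB : B.Nodup) (hB' : ∀ L ∈ B, L ≠ 0 ∧ L ∉ rows.map Prod.snd)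
    (h : ¬ B <+: l) :
    gridSum β ts rows l (wordDelta (B ++ C)) = 0 := by
  obtain ⟨p, L, h1, h2⟩ := exists_notMem_take_of_not_isPrefix_word hB h
  have hL := hB' L (List.mem_of_mem_take h1)
  refine gridSum_eq_zero_of_notMem_take β hL.1 ts rows l p _ (fun v hv => ?_) hL.2 h2
  refine if_neg ?_
  rintro rfl
  refine hv ?_
  rw [List.take_append]
  exact List.mem_append_left _ h1

theorem rowSum_replicate_zero (β z : R) (T : List R) (F : List ℕ → R) :
    rowSum β z T (List.replicate T.length 0) 0 F =
      (T.map fun t => t + z + β * t * z).prod * F (List.replicate T.length 0) := by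
  induction T generalizing F with
  | nil => simp [rowSum]
  | cons t T ih =>
    simp only [List.length_cons, List.replicate_succ, rowSum, tileSum, if_true, ih,
      List.map_cons, List.prod_cons]
    ring

theorem rowSum_staircase (β z : R) (TA T : List R) (t : R) (A : List ℕ) (h : ℕ)
    (hlen : TA.length = A.length) (hh : 0 < h) (hA : ∀ a ∈ A, h < a) (F : List ℕ → R)
    (hF : ∀ l, ¬ (A ++ [h]) <+: l → F l = 0) :
    rowSum β z (TA ++ t :: T) (A ++ 0 :: List.replicate T.length 0) h F =
      (T.map fun t => t + z + β * t * z).prod *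
        F (A ++ h :: List.replicate T.length 0) := by
  induction A generalizing TA F with
  | nil =>
    obtain rfl : TA = [] := by simpa using hlen
    have e : (fun l => F (0 :: l)) = fun _ => 0 := by
      funext l
      refine hF _ ?_
      simp [List.cons_prefix_cons, hh.ne']
    simp only [List.nil_append, rowSum, tileSum, hh.ne', if_true, if_false, e, rowSum_zero,
      zero_add, rowSum_replicate_zero]
  | cons a A ih =>
    cases TA with
    | nil => simp at hlen
    | cons s TA =>
      have ha := hA a (by simp)
      have e : (fun l => F (h :: l)) = fun _ => 0 := by
        funext l
        refine hF _ ?_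
        simp [List.cons_prefix_cons, ha.ne']
      simp only [List.cons_append, rowSum, tileSum, hh.ne', (hh.trans ha).ne', ha, if_true,
        if_false, e, rowSum_zero, mul_zero, add_zero]
      refine ih TA (by simpa using hlen) (fun b hb => hA b (by simp [hb])) _ fun l hl => hF _ ?_
      simpa [List.cons_prefix_cons] using hl

theorem gridSum_staircase (β : R) (TA : List R) (τ : ℕ → R) (ζ : ℕ → R) (m : ℕ)
    (A : List ℕ) (hlen : TA.length = A.length) (hA : ∀ a ∈ A, m < a) (hnd : A.Nodup) :
    gridSum β (TA ++ downList τ m) (downList (fun j => (ζ j, j + 1)) m)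
      (A ++ List.replicate m 0)
      (wordDelta (A ++ downList (fun j => j + 1) m)) =
      ∏ j ∈ Finset.range m, ∏ i ∈ Finset.range j, (τ i + ζ j + β * τ i * ζ j) := by
  induction m generalizing TA A with
  | zero => simp [downList, gridSum, wordDelta]
  | succ m ih =>
    have hprod : ((downList τ m).map fun t => t + ζ m + β * t * ζ m).prod =
        ∏ i ∈ Finset.range m, (τ i + ζ m + β * τ i * ζ m) := by
      rw [map_downList, prod_downList]
    have h1 := rowSum_staircase β (ζ m) TA (downList τ m) (τ m) A (m + 1) hlen (by omega)
      hA (fun l => gridSum β (TA ++ downList τ (m + 1)) (downList (fun j => (ζ j, j + 1)) m) l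
        (wordDelta (A ++ downList (fun j => j + 1) (m + 1))))
      (fun l hl => by
        have := gridSum_eq_zero_of_not_isPrefix_word β (TA ++ downList τ (m + 1))
          (downList (fun j => (ζ j, j + 1)) m) l (A ++ [m + 1]) (downList (fun j => j + 1) m)
          (by
            rw [List.nodup_append]
            refine ⟨hnd, by simp, ?_⟩
            intro a ha b hb
            have := hA a ha
            simp at hb
            omega)
          (by
            intro L hL
            rw [map_downList, mem_downList]
            have : m + 1 ≤ L := by
              rcases List.mem_append.mp hL with h | h
              · exact (hA L h).le
              · simp at h; omega
            refine ⟨by omega, ?_⟩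
            rintro ⟨j, hj, rfl⟩
            simp only at this
            omega) hl
        simpa [downList] using this)
    rw [length_downList] at h1
    have h2 := ih (TA ++ [τ m]) (A ++ [m + 1]) (by simp [hlen])
      (by
        intro a ha
        rcases List.mem_append.mp ha with h | h
        · exact (Nat.lt_succ_self m).trans (hA a h)
        · simp at h; omega)
      (by
        rw [List.nodup_append]
        refine ⟨hnd, by simp, ?_⟩
        intro a ha b hb
        have := hA a ha
        simp at hb
        omega)
    simp only [List.append_assoc, List.cons_append, List.nil_append] at h2
    rw [Finset.prod_range_succ, ← h2, ← hprod, mul_comm]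
    exact h1

end Longest

/-! ### The Demazure recursion for the partition function -/

section Recursion

theorem filter_downList_eq_nil {α : Type*} {p : α → Bool} {f : ℕ → α} {n : ℕ}
    (h : ∀ j < n, ¬ p (f j)) : (downList f n).filter p = [] := by
  rw [List.filter_eq_nil_iff]
  intro a ha
  obtain ⟨j, hj, rfl⟩ := mem_downList.mp ha
  exact h j hj

theorem filter_downList_eq_singleton {α : Type*} {p : α → Bool} {f : ℕ → α} {n r : ℕ}
    (hr : r < n) (h : ∀ j < n, p (f j) ↔ j = r) : (downList f n).filter p = [f r] := by
  induction n with
  | zero => omega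
  | succ n ih =>
    by_cases hn : r = n
    · subst hn
      rw [downList, List.filter_cons_of_pos ((h r hr).2 rfl),
        filter_downList_eq_nil fun j hj hp => hj.ne ((h j (by omega)).1 hp)]
    · rw [downList, List.filter_cons_of_neg fun hp => hn ((h n (by omega)).1 hp).symm,
        ih (by omega) fun j hj => h j (by omega)]

theorem filter_downList_eq_pair {α : Type*} {p : α → Bool} {f : ℕ → α} {n q r : ℕ}
    (hqr : q < r) (hr : r < n) (h : ∀ j < n, p (f j) ↔ j = q ∨ j = r) :
    (downList f n).filter p = [f r, f q] := by
  induction n with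
  | zero => omega
  | succ n ih =>
    by_cases hn : r = n
    · subst hn
      rw [downList, List.filter_cons_of_pos ((h r hr).2 (Or.inr rfl)),
        filter_downList_eq_singleton hqr fun j hj => ?_]
      rw [h j (by omega)]
      omega
    · have hneg : ¬ p (f n) := by
        rw [h n (by omega)]
        omega
      rw [downList, List.filter_cons_of_neg hneg, ih (by omega) fun j hj => h j (by omega)]

theorem downList_split {α : Type*} (f : ℕ → α) (i m : ℕ) :
    downList f (i + 2 + m) =
      downList (fun j => f (i + 2 + j)) m ++ f (i + 1) :: f i :: downList f i := by
  rw [downList_add]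
  rfl

theorem downList_swap_split {α : Type*} (f : ℕ → α) (i m : ℕ) :
    downList (fun j => f (Equiv.swap i (i + 1) j)) (i + 2 + m) =
      downList (fun j => f (i + 2 + j)) m ++ f i :: f (i + 1) :: downList f i := by
  rw [downList_split, Equiv.swap_apply_left, Equiv.swap_apply_right]
  congr 1
  · refine downList_congr fun j _ => ?_
    rw [Equiv.swap_apply_of_ne_of_ne (by omega) (by omega)]
  · congr 2
    refine downList_congr fun j _ => ?_
    rw [Equiv.swap_apply_of_ne_of_ne (by omega) (by omega)]

variable {R : Type*} [CommRing R]

theorem gridSum_linear (β c d : R) (ts : List R) (rows : List (R × ℕ)) (vs : List ℕ)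
    (F G : List ℕ → R) :
    gridSum β ts rows vs (fun l => c * F l + d * G l) =
      c * gridSum β ts rows vs F + d * gridSum β ts rows vs G := by
  induction rows generalizing vs with
  | nil => rfl
  | cons p rows ih => simp only [gridSum, ih, rowSum_linear]

theorem rMatrix_wordDelta (β a b : R) {c : ℕ} (hc : 0 < c) (P Q l : List ℕ) :
    rMatrix β a b P.length (wordDelta (P ++ (c + 1) :: c :: Q)) l =
      (1 + β * b) * wordDelta (P ++ (c + 1) :: c :: Q) l +
        (a - b) * wordDelta (P ++ c :: (c + 1) :: Q) l := by
  induction P generalizing l with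
  | nil =>
    rcases l with _ | ⟨x, _ | ⟨y, l⟩⟩
    · simp [rMatrix, wordDelta]
    · simp [rMatrix, wordDelta]
    · have h1 : diagCoeff β a b x y * wordDelta ((c + 1) :: c :: Q) (x :: y :: l) =
          (1 + β * b) * wordDelta ((c + 1) :: c :: Q) (x :: y :: l) := by
        unfold wordDelta
        split_ifs with h
        · simp only [List.cons.injEq] at h
          obtain ⟨rfl, rfl, -⟩ := h
          simp [diagCoeff, hc.ne']
        · simp
      have h2 : swapCoeff a b x y * wordDelta ((c + 1) :: c :: Q) (y :: x :: l) =
          (a - b) * wordDelta (c :: (c + 1) :: Q) (x :: y :: l) := by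
        have e : (y :: x :: l = (c + 1) :: c :: Q) ↔ (x :: y :: l = c :: (c + 1) :: Q) := by
          simp only [List.cons.injEq]
          tauto
        simp only [wordDelta, e]
        split_ifs with h
        · simp only [List.cons.injEq] at h
          obtain ⟨rfl, rfl, -⟩ := h
          simp [swapCoeff]
        · simp
      simp only [List.nil_append, List.length_nil, rMatrix, h1, h2]
  | cons p P ih =>
    cases l with
    | nil => simp [rMatrix, wordDelta]
    | cons x l =>
      simp only [List.length_cons, rMatrix, List.cons_append]
      by_cases hx : x = p
      · subst hx
        have e : ∀ w : List ℕ, (fun l => wordDelta (R := R) (x :: w) (x :: l)) = wordDelta w := by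
          intro w
          funext l
          simp [wordDelta]
        have e' : ∀ w : List ℕ, wordDelta (R := R) (x :: w) (x :: l) = wordDelta w l :=
          fun w => congrFun (e w) l
        rw [e, e', e', ih]
      · simp [wordDelta, hx, rMatrix_zero]

/-- The partition function of the `n × n` grid whose right boundary is given by `u`. -/
def bpdSum (β : R) (τ ζ : ℕ → R) (n : ℕ) (u : Equiv.Perm ℕ) : R :=
  gridSum β (downList τ n) ((List.range n).map fun r => (ζ r, u⁻¹ r + 1))
    (List.replicate n 0) (wordDelta (downList (fun j => j + 1) n))

theorem map_bpdSum {S : Type*} [CommRing S] (φ : R →+* S) (β : R) (τ ζ : ℕ → R) (n : ℕ)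
    (u : Equiv.Perm ℕ) :
    φ (bpdSum β τ ζ n u) = bpdSum (φ β) (fun j => φ (τ j)) (fun j => φ (ζ j)) n u := by
  rw [bpdSum, map_gridSum, map_downList, List.map_map, bpdSum]
  congr 1
  funext l
  simp [wordDelta, apply_ite φ]

theorem pairWord_replicate_zero {c : ℕ} (hc : 0 < c) (n : ℕ) :
    pairWord c (List.replicate n 0) = [] := by
  simp only [pairWord, List.filter_eq_nil_iff, List.mem_replicate, decide_eq_true_eq]
  omega

theorem bpdSum_exchange (β : R) (τ ζ : ℕ → R) (i m : ℕ) {w : Equiv.Perm ℕ}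
    (hw : InSn (i + 2 + m) w) (hi : w (i + 1) < w i) :
    gridSum β (downList τ (i + 2 + m))
        ((List.range (i + 2 + m)).map fun r => (ζ r, w⁻¹ r + 1))
        (List.replicate (i + 2 + m) 0)
        (wordDelta ((downList (fun j => j + 1) (i + 2 + m)).map
          (Equiv.swap (i + 1) (i + 2)))) =
      bpdSum β τ ζ (i + 2 + m) (w * sTr i) + β * bpdSum β τ ζ (i + 2 + m) w := by
  set n := i + 2 + m with hn
  have hwi : w i < n := by
    by_contra hcon
    have := w.injective (hw _ (not_lt.mp hcon))
    omega
  have htgt : pairWord (i + 1) (downList (fun j => j + 1) n) = [i + 1 + 1, i + 1] :=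
    filter_downList_eq_pair (q := i) (r := i + 1) (by omega) (by omega) fun j _ => by
      simp only [decide_eq_true_eq]
      omega
  have key := (gridSum_exchange β (c := i + 1) (by omega) (downList τ n)
    ((List.range n).map fun r => (ζ r, w⁻¹ r + 1)) (List.replicate n 0)
    (wordDelta ((downList (fun j => j + 1) n).map (Equiv.swap (i + 1) (i + 1 + 1))))
    (wordDelta (downList (fun j => j + 1) n)) ?_ ?_).1 ?_
  · rw [show i + 2 = i + 1 + 1 from rfl, key]
    congr 1
    rw [bpdSum, List.map_replicate,
      Equiv.swap_apply_of_ne_of_ne (by omega) (by omega), List.map_map]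
    congr 1
    refine List.map_congr_left fun r _ => ?_
    simp only [Function.comp_apply, Prod.map_apply, id_eq, mul_inv_rev, sTr, Equiv.swap_inv,
      Equiv.Perm.mul_apply, Prod.mk.injEq, true_and]
    rw [Equiv.swap_apply_def, Equiv.swap_apply_def]
    split_ifs <;> omega
  · intro v hv
    have h1 : v ≠ downList (fun j => j + 1) n := by
      rintro rfl
      rw [htgt] at hv
      simp at hv
    have h2 : v = (downList (fun j => j + 1) n).map (Equiv.swap (i + 1) (i + 1 + 1)) ↔
        v.map (Equiv.swap (i + 1) (i + 1 + 1)) = downList (fun j => j + 1) n := by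
      constructor
      · rintro rfl
        simp [Function.comp_def]
      · intro h
        rw [← h]
        simp [Function.comp_def]
    simp [wordDelta, h1, h2]
  · intro v hv
    refine if_neg ?_
    rintro rfl
    rw [pairWord_map_swap, htgt] at hv
    simp at hv
  · rw [pairWord_append, pairWord_replicate_zero (by omega), List.append_nil, List.map_map,
      reverse_map_range]
    have := filter_downList_eq_pair (p := fun x => decide (x = i + 1 ∨ x = i + 1 + 1))
      (f := fun r => w⁻¹ r + 1) (n := n) hi hwi fun j _ => by
        simp only [decide_eq_true_eq, Nat.add_right_cancel_iff, Equiv.Perm.inv_eq_iff_eq]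
        constructor
        · rintro (h | h)
          exacts [Or.inr h, Or.inl h]
        · rintro (h | h)
          exacts [Or.inr h, Or.inl h]
    have e : ∀ j, w⁻¹ (w j) = j := w.symm_apply_apply
    simp only [e] at this
    exact this

theorem bpdSum_demazure (β : R) (τ ζ : ℕ → R) {n i : ℕ} (hin : i + 1 < n)
    {w : Equiv.Perm ℕ} (hw : InSn n w) (hi : w (i + 1) < w i) :
    (τ i - τ (i + 1)) * bpdSum β τ ζ n (w * sTr i) =
      (1 + β * τ (i + 1)) * bpdSum β τ ζ n w -
        (1 + β * τ i) * bpdSum β (fun j => τ (Equiv.swap i (i + 1) j)) ζ n w := by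
  obtain ⟨m, rfl⟩ : ∃ m, n = i + 2 + m := ⟨n - (i + 2), by omega⟩
  have ex := bpdSum_exchange β τ ζ i m hw hi
  have yb := gridSum_yangBaxter β (τ (i + 1)) (τ i) (downList (fun j => τ (i + 2 + j)) m)
    (downList τ i) ((List.range (i + 2 + m)).map fun r => (ζ r, w⁻¹ r + 1))
    (List.replicate (i + 2 + m) 0) (wordDelta (downList (fun j => j + 1) (i + 2 + m)))
  rw [← downList_split, ← downList_swap_split, length_downList] at yb
  have hz : List.replicate (i + 2 + m) 0 =
      List.replicate m 0 ++ 0 :: 0 :: List.replicate i 0 := by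
    rw [show i + 2 + m = m + (i + 2) by omega, List.replicate_add]
    rfl
  have hR : rMatrix β (τ (i + 1)) (τ i) m (fun vs => gridSum β
        (downList (fun j => τ (Equiv.swap i (i + 1) j)) (i + 2 + m))
        ((List.range (i + 2 + m)).map fun r => (ζ r, w⁻¹ r + 1)) vs
        (wordDelta (downList (fun j => j + 1) (i + 2 + m)))) (List.replicate (i + 2 + m) 0) =
      (1 + β * τ i) * bpdSum β (fun j => τ (Equiv.swap i (i + 1) j)) ζ (i + 2 + m) w := by
    have := rMatrix_append β (τ (i + 1)) (τ i) (List.replicate m 0) (List.replicate i 0) 0 0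
      (fun vs => gridSum β
        (downList (fun j => τ (Equiv.swap i (i + 1) j)) (i + 2 + m))
        ((List.range (i + 2 + m)).map fun r => (ζ r, w⁻¹ r + 1)) vs
        (wordDelta (downList (fun j => j + 1) (i + 2 + m))))
    rw [List.length_replicate, ← hz] at this
    rw [this]
    simp [diagCoeff, swapCoeff, bpdSum]
  have hD : rMatrix β (τ (i + 1)) (τ i) m
        (wordDelta (downList (fun j => j + 1) (i + 2 + m))) = fun l =>
      (1 + β * τ i) * wordDelta (downList (fun j => j + 1) (i + 2 + m)) l +
        (τ (i + 1) - τ i) * wordDelta ((downList (fun j => j + 1) (i + 2 + m)).map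
          (Equiv.swap (i + 1) (i + 2))) l := by
    funext l
    have e : (downList (fun j => j + 1) (i + 2 + m)).map (Equiv.swap (i + 1) (i + 2)) =
        downList (fun j => i + 2 + j + 1) m ++ (i + 1) :: (i + 2) ::
          downList (fun j => j + 1) i := by
      rw [← downList_swap_split (fun j => j + 1), map_downList]
      refine downList_congr fun j _ => ?_
      rw [Equiv.swap_apply_def, Equiv.swap_apply_def]
      split_ifs <;> omega
    have := rMatrix_wordDelta β (τ (i + 1)) (τ i) (c := i + 1) (by omega)
      (downList (fun j => i + 2 + j + 1) m) (downList (fun j => j + 1) i) l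
    rw [length_downList] at this
    rw [e, downList_split]
    exact this
  rw [hR, hD, gridSum_linear, ex] at yb
  change (1 + β * τ i) * bpdSum β τ ζ (i + 2 + m) w + _ = _ at yb
  linear_combination -yb

end Recursion

/-! ### Identification with the double Grothendieck polynomials -/

section Grothendieck

theorem inSn_lt {n : ℕ} {u : Equiv.Perm ℕ} (hu : InSn n u) {j : ℕ} (hj : j < n) : u j < n := by
  by_contra hcon
  have := u.injective (hu _ (not_lt.mp hcon))
  omega

theorem inSn_inv {n : ℕ} {u : Equiv.Perm ℕ} (hu : InSn n u) : InSn n u⁻¹ := fun j hj => by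
  rw [Equiv.Perm.inv_eq_iff_eq, hu j hj]

theorem eq_revPerm_of_antitone {n : ℕ} {u : Equiv.Perm ℕ} (hu : InSn n u)
    (h : ∀ i, i + 1 < n → u (i + 1) < u i) : u = revPerm n := by
  have upper : ∀ j, j < n → u j + j < n := by
    intro j
    induction j with
    | zero => exact fun hj => inSn_lt hu hj
    | succ j ih =>
      intro hj
      have := ih (by omega)
      have := h j hj
      omega
  have lower : ∀ d j, j + d + 1 = n → d ≤ u j := by
    intro d
    induction d with
    | zero => intros; omega
    | succ d ih =>
      intro j hj
      have := ih (j + 1) (by omega)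
      have := h j (by omega)
      omega
  ext j
  change u j = if j < n then n - 1 - j else j
  split_ifs with hj
  · have := upper j hj
    have := lower (n - 1 - j) j (by omega)
    omega
  · exact hu j (by omega)

theorem inSn_mul_sTr {n i : ℕ} (hi : i + 1 < n) {u : Equiv.Perm ℕ} (hu : InSn n u) :
    InSn n (u * sTr i) := fun j hj => by
  rw [Equiv.Perm.mul_apply, sTr, Equiv.swap_apply_of_ne_of_ne (by omega) (by omega), hu j hj]

theorem sum_mul_sTr_lt {n i : ℕ} (hi : i + 1 < n) {u : Equiv.Perm ℕ} (h : u i < u (i + 1)) :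
    ∑ j ∈ Finset.range n, j * (u * sTr i) j < ∑ j ∈ Finset.range n, j * u j := by
  have e : ∀ w : ℕ → ℕ, ∑ j ∈ Finset.range n, j * w j =
      ∑ j ∈ (Finset.range n \ {i, i + 1}), j * w j + (i * w i + (i + 1) * w (i + 1)) := by
    intro w
    rw [← Finset.sum_sdiff (s₁ := {i, i + 1}) (s₂ := Finset.range n), Finset.sum_pair (by omega)]
    intro j hj
    simp only [Finset.mem_insert, Finset.mem_singleton] at hj
    rw [Finset.mem_range]
    omega
  rw [e, e]
  have h1 : ∑ j ∈ (Finset.range n \ {i, i + 1}), j * (u * sTr i) j =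
      ∑ j ∈ (Finset.range n \ {i, i + 1}), j * u j := by
    refine Finset.sum_congr rfl fun j hj => ?_
    simp only [Finset.mem_sdiff, Finset.mem_insert, Finset.mem_singleton, not_or] at hj
    rw [Equiv.Perm.mul_apply, sTr, Equiv.swap_apply_of_ne_of_ne hj.2.1 hj.2.2]
  rw [h1]
  simp only [Equiv.Perm.mul_apply, sTr, Equiv.swap_apply_left, Equiv.swap_apply_right]
  nlinarith

theorem bpdSum_revPerm {R : Type*} [CommRing R] (β : R) (τ ζ : ℕ → R) (n : ℕ) :
    bpdSum β τ ζ n (revPerm n) =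
      ∏ i ∈ Finset.range n, ∏ j ∈ Finset.range (n - 1 - i),
        (τ i + ζ j + β * τ i * ζ j) := by
  have hrows : (List.range n).map (fun r => (ζ r, (revPerm n)⁻¹ r + 1)) =
      downList (fun j => (ζ (n - 1 - j), j + 1)) n := by
    rw [map_range_eq_downList]
    refine downList_congr fun j hj => ?_
    have : (revPerm n)⁻¹ (n - 1 - j) = j := by
      rw [Equiv.Perm.inv_eq_iff_eq]
      change _ = if j < n then n - 1 - j else j
      rw [if_pos hj]
    simp [this]
  have key := gridSum_staircase β [] τ (fun j => ζ (n - 1 - j)) n [] rfl (by simp) (by simp)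
  simp only [List.nil_append] at key
  rw [bpdSum, hrows, key,
    ← Finset.prod_range_reflect (fun j => ∏ i ∈ Finset.range j,
      (τ i + ζ (n - 1 - j) + β * τ i * ζ (n - 1 - j)))]
  rw [Finset.prod_comm' (t' := Finset.range n)
    (s' := fun i => Finset.range (n - 1 - i))]
  · refine Finset.prod_congr rfl fun i _ => Finset.prod_congr rfl fun j hj => ?_
    rw [Finset.mem_range] at hj
    rw [show n - 1 - (n - 1 - j) = j by omega]
  · intro j i
    simp only [Finset.mem_range]
    omega

theorem grothendieck_eq_bpdSum {K : Type*} [Field K] {β : K}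
    {G : (ℕ → K) → Equiv.Perm ℕ → MvPolynomial ℕ K} (hG : GrothFamily β G) {n : ℕ}
    {y : ℕ → K} (hy : ∀ j, 1 + β * y j ≠ 0) (u : Equiv.Perm ℕ) (hu : InSn n u) :
    G y u = bpdSum (C β) X (fun j => C (-y j / (1 + β * y j))) n u := by
  by_cases hdes : ∀ i, i + 1 < n → u (i + 1) < u i
  · rw [eq_revPerm_of_antitone hu hdes, (hG y hy).1 n, bpdSum_revPerm]
    refine Finset.prod_congr rfl fun i _ => Finset.prod_congr rfl fun j _ => ?_
    have h1 : C (1 + β * y j) * C ((1 + β * y j)⁻¹) = (1 : MvPolynomial ℕ K) := by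
      rw [← C_mul, mul_inv_cancel₀ (hy j), C_1]
    rw [div_eq_mul_inv, C_mul, C_neg]
    simp only [C_add, C_1, C_mul] at h1
    linear_combination X i * h1
  · push Not at hdes
    obtain ⟨i, hin, hi⟩ := hdes
    have hlt : u i < u (i + 1) :=
      lt_of_le_of_ne hi fun h => by simpa using u.injective h
    have hdec := sum_mul_sTr_lt hin hlt
    have hw := inSn_mul_sTr hin hu
    have hwi : (u * sTr i) (i + 1) < (u * sTr i) i := by
      simpa [sTr] using hlt
    have hback : u * sTr i * sTr i = u := by
      rw [mul_assoc, sTr, Equiv.swap_mul_self, mul_one]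
    have ih := grothendieck_eq_bpdSum hG hy (u * sTr i) hw
    have h1 := (hG y hy).2 (u * sTr i) i hwi
    have h2 := bpdSum_demazure (C β) (X : ℕ → MvPolynomial ℕ K)
      (fun j => C (-y j / (1 + β * y j))) hin hw hwi
    have h3 : rename ⇑(Equiv.swap i (i + 1)) (G y (u * sTr i)) =
        bpdSum (C β) (fun j => (X (Equiv.swap i (i + 1) j) : MvPolynomial ℕ K))
          (fun j => C (-y j / (1 + β * y j))) n (u * sTr i) := by
      rw [ih]
      have := map_bpdSum (rename (R := K) ⇑(Equiv.swap i (i + 1))).toRingHom (C β) X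
        (fun j => C (-y j / (1 + β * y j))) n (u * sTr i)
      simpa using this
    rw [h3, ih, ← h2, hback] at h1
    refine mul_left_cancel₀ ?_ h1
    rw [sub_ne_zero]
    exact fun h => by simpa using X_injective h
termination_by ∑ j ∈ Finset.range n, j * u j
decreasing_by exact hdec

end Grothendieck

/-! ### Expansion of the partition function over lattice states -/

section States

variable {K : Type*} [Field K]

/-- The word of a family of column labels, read from right to left. -/
def finWord {M m : ℕ} (v : Fin m → Fin M) : List ℕ := (List.ofFn fun j => (v j : ℕ)).reverse

theorem finWord_snoc {M m : ℕ} (v : Fin m → Fin M) (a : Fin M) :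
    finWord (Fin.snoc (α := fun _ => Fin M) v a) = (a : ℕ) :: finWord v := by
  rw [finWord, List.ofFn_succ', List.concat_eq_append, List.reverse_append]
  simp [finWord]

theorem finWord_eq_downList {M m : ℕ} (v : Fin m → Fin M) (f : ℕ → ℕ)
    (h : ∀ j, (v j : ℕ) = f j) : finWord v = downList f m := by
  rw [finWord, ← reverse_map_range]
  congr 1
  refine List.ext_getElem (by simp) fun j h₁ h₂ => by simp [h]

theorem finWord_injective {M m : ℕ} :
    Function.Injective (finWord : (Fin m → Fin M) → List ℕ) := fun v w h => by
  have := List.ofFn_injective (List.reverse_injective h)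
  funext j
  exact Fin.ext (congrFun this j)

theorem Lwt_eq {β : K} {k : ℕ} {x : K} {N E : ℕ} (hN : N ≤ k) (hE : E ≤ k) (W S : ℕ) :
    Lwt β k x N E W S = tileSum β x (fun W' S' => if W = W' ∧ S = S' then 1 else 0) N E := by
  unfold Lwt tileSum
  rcases Nat.eq_zero_or_pos N with rfl | hN0 <;> rcases Nat.eq_zero_or_pos E with rfl | hE0
  · grind
  · grind
  · grind
  · by_cases hEN : E < N
    · simp only [hN0.ne', hE0.ne', hN0, hE0, hEN, hN, hN.not_gt, hE.not_gt]
      grind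
    · simp [hN0.ne', hE0.ne', hEN, hE.not_gt]

theorem tileSum_eq_sum {M : ℕ} (β : K) {k : ℕ} (hM : M ≤ k + 1) (x : K) (f : ℕ → ℕ → K)
    (N E : Fin M) :
    tileSum β x f N E = ∑ W : Fin M, ∑ S : Fin M, Lwt β k x N E W S * f W S := by
  have hpt : ∀ W' S' : Fin M, ∑ W : Fin M, ∑ S : Fin M,
      (if (W : ℕ) = W' ∧ (S : ℕ) = S' then (1 : K) else 0) * f W S = f W' S' := by
    intro W' S'
    rw [Finset.sum_eq_single W', Finset.sum_eq_single S'] <;>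
      simp +contextual [Fin.val_inj]
  have hz : 0 < M := by have := N.2; omega
  simp only [Lwt_eq (show (N : ℕ) ≤ k by omega) (show (E : ℕ) ≤ k by omega)]
  have p1 := hpt E N
  have p2 := hpt N E
  have p3 := hpt ⟨0, hz⟩ ⟨0, hz⟩
  have p4 := hpt E ⟨0, hz⟩
  have p5 := hpt ⟨0, hz⟩ E
  have p6 := hpt N ⟨0, hz⟩
  have p7 := hpt ⟨0, hz⟩ N
  simp only at p3 p4 p5 p6 p7
  unfold tileSum
  split_ifs <;> simp only [add_mul, mul_assoc, Finset.sum_add_distrib, ← Finset.mul_sum, p1, p2,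
    p3, p4, p5, p6, p7, zero_mul, Finset.sum_const_zero]

theorem sum_eq_sum_snoc {M m : ℕ} (f : (Fin (m + 1) → Fin M) → K) :
    ∑ S, f S = ∑ a, ∑ S : Fin m → Fin M, f (Fin.snoc (α := fun _ => Fin M) S a) := by
  rw [← (Fin.snocEquiv fun _ => Fin M).sum_comp, Fintype.sum_prod_type]
  rfl

/-- The weight of a row configuration with parameter `z`, north labels `N`, south labels
`S` and horizontal labels `H`. -/
def rowWt (β z : K) (k : ℕ) (τ : ℕ → K) {M m : ℕ} (N S : Fin m → Fin M)
    (H : Fin (m + 1) → Fin M) : K :=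
  ∏ j : Fin m, Lwt β k (τ j + z + β * τ j * z) (N j) (H j.succ) (H j.castSucc) (S j)

theorem rowSum_eq_sum {M m : ℕ} (β z : K) {k : ℕ} (hM : M ≤ k + 1) (τ : ℕ → K)
    (N : Fin m → Fin M) (h : Fin M) (F : List ℕ → K) :
    rowSum β z (downList τ m) (finWord N) h F =
      ∑ S : Fin m → Fin M, ∑ H : Fin (m + 1) → Fin M,
        if (H 0 : ℕ) = 0 ∧ H (Fin.last m) = h then rowWt β z k τ N S H * F (finWord S)
          else 0 := by
  induction m generalizing h F with
  | zero =>
    have hw (v : Fin 0 → Fin M) : finWord v = [] := rfl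
    rw [Fintype.sum_unique, Finset.sum_eq_single fun _ => h]
    · simp [hw, downList, rowSum, rowWt]
    · intro H _ hH
      refine if_neg fun hh => hH (funext fun i => ?_)
      rw [← hh.2, Fin.fin_one_eq_zero i]
      rfl
    · simp
  | succ m ih =>
    obtain ⟨N, a, rfl⟩ : ∃ (N' : Fin m → Fin M) (a : Fin M), N = Fin.snoc N' a :=
      ⟨Fin.init N, N (Fin.last m), (Fin.snoc_init_self N).symm⟩
    rw [finWord_snoc, downList, rowSum, tileSum_eq_sum β hM]
    simp only [ih, Finset.mul_sum]
    rw [sum_eq_sum_snoc, Finset.sum_comm]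
    refine Finset.sum_congr rfl fun b _ => ?_
    rw [Finset.sum_comm]
    refine Finset.sum_congr rfl fun S _ => ?_
    rw [sum_eq_sum_snoc, Finset.sum_comm, Finset.sum_comm (s := Finset.univ (α := Fin M))]
    refine Finset.sum_congr rfl fun H _ => ?_
    rw [Finset.sum_eq_single (H (Fin.last m)) (by simp +contextual [eq_comm]) (by simp),
      Finset.sum_eq_single h (by simp +contextual) (by simp), finWord_snoc]
    have h0 : (0 : Fin (m + 1 + 1)) = (0 : Fin (m + 1)).castSucc := rfl
    have hw : rowWt β z k τ (Fin.snoc (α := fun _ => Fin M) N a)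
        (Fin.snoc (α := fun _ => Fin M) S b) (Fin.snoc (α := fun _ => Fin M) H h) =
        Lwt β k (τ m + z + β * τ m * z) a h (H (Fin.last m)) b * rowWt β z k τ N S H := by
      rw [rowWt, Fin.prod_univ_castSucc, mul_comm]
      simp only [rowWt, Fin.succ_last, ← Fin.castSucc_succ, Fin.snoc_last,
        Fin.snoc_castSucc, Fin.val_castSucc, Fin.val_last]
    rw [hw, h0]
    simp only [Fin.snoc_castSucc, Fin.snoc_last, and_true, mul_ite, mul_zero, mul_assoc]

theorem gridSum_eq_sum {M n r : ℕ} (β : K) {k : ℕ} (hM : M ≤ k + 1) (τ : ℕ → K)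
    (z : Fin r → K) (c : Fin r → Fin M) (v : Fin n → Fin M) (F : List ℕ → K) :
    gridSum β (downList τ n) (List.ofFn fun i => (z i, (c i : ℕ))) (finWord v) F =
      ∑ V : Fin (r + 1) → Fin n → Fin M, if V 0 = v then
        (∏ i : Fin r, ∑ H : Fin (n + 1) → Fin M, if (H 0 : ℕ) = 0 ∧ H (Fin.last n) = c i then
          rowWt β (z i) k τ (V i.castSucc) (V i.succ) H else 0) * F (finWord (V (Fin.last r)))
        else 0 := by
  induction r generalizing v with
  | zero =>
    rw [Finset.sum_eq_single fun _ => v]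
    · simp [gridSum]
    · intro V _ hV
      refine if_neg fun hh => hV (funext fun i => ?_)
      rw [← hh, Fin.fin_one_eq_zero i]
    · simp
  | succ r ih =>
    rw [List.ofFn_succ, gridSum, rowSum_eq_sum β _ hM]
    have hrow (S : Fin n → Fin M) (c' : K) : (∑ H : Fin (n + 1) → Fin M,
        if (H 0 : ℕ) = 0 ∧ H (Fin.last n) = c 0 then rowWt β (z 0) k τ v S H * c' else 0) =
        (∑ H : Fin (n + 1) → Fin M, if (H 0 : ℕ) = 0 ∧ H (Fin.last n) = c 0 then
          rowWt β (z 0) k τ v S H else 0) * c' := by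
      simp only [Finset.sum_mul, ite_mul, zero_mul]
    simp only [hrow]
    rw [← (Fin.consEquiv fun _ => Fin n → Fin M).sum_comp, Fintype.sum_prod_type]
    refine Eq.trans ?_ (Finset.sum_eq_single v (by simp +contextual) (by simp)).symm
    simp only [ih, Fin.consEquiv_apply, Fin.cons_zero, if_true, ← Fin.succ_last, Fin.cons_succ,
      Fin.prod_univ_succ, Fin.castSucc_zero, ← Fin.succ_castSucc]
    simp only [Finset.mul_sum (s := Finset.univ (α := Fin (r + 1) → Fin n → Fin M))]
    rw [Finset.sum_comm]
    refine Finset.sum_congr rfl fun V _ => ?_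
    rw [Finset.sum_eq_single (V 0) (by simp +contextual [eq_comm]) (by simp), if_pos rfl,
      mul_assoc]

theorem prod_ite_eq {ι : Type*} [Fintype ι] (p : ι → Prop) [DecidablePred p] (f : ι → K) :
    (∏ i, if p i then f i else 0) = if ∀ i, p i then ∏ i, f i else 0 := by
  split_ifs with h
  · exact Finset.prod_congr rfl fun i _ => if_pos (h i)
  · push Not at h
    obtain ⟨i, hi⟩ := h
    exact Finset.prod_eq_zero (Finset.mem_univ i) (if_neg hi)

theorem Lwt_eq_zero {β : K} {k : ℕ} {x : K} {N E W S : ℕ} (h : ¬ LAdm k N E W S) :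
    Lwt β k x N E W S = 0 := by
  unfold LAdm at h
  unfold Lwt
  push Not at h
  rw [if_neg, if_neg, if_neg, if_neg, if_neg, if_neg, if_neg, if_neg, if_neg, if_neg, if_neg] <;>
    grind

open Classical in
theorem finsum_PP_eq_sum (β : K) (t y : ℕ → K) (n k : ℕ) (u v w : Equiv.Perm ℕ) :
    ∑ᶠ π ∈ PP n k u v w, stateWt β k t y π =
      ∑ π : GridState n, if BoundaryCond n k u v w π then stateWt β k t y π else 0 := by
  rw [finsum_mem_eq_finite_toFinset_sum _ (Set.toFinite _), ← Finset.sum_filter]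
  refine Finset.sum_subset (fun π hπ => ?_) fun π hπ hπ' => ?_
  · simpa using ((Set.Finite.mem_toFinset _).1 hπ).1
  · rw [Set.Finite.mem_toFinset] at hπ'
    have hb : BoundaryCond n k u v w π := by simpa using hπ
    obtain ⟨i, hi⟩ := not_forall.1 fun h => hπ' ⟨hb, h⟩
    obtain ⟨j, hj⟩ := not_forall.1 hi
    exact Finset.prod_eq_zero (Finset.mem_univ i)
      (Finset.prod_eq_zero (Finset.mem_univ j) (Lwt_eq_zero hj))

theorem ominus_eq {β a b : K} (h : 1 + β * b ≠ 0) :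
    ominus β a b = a + -b / (1 + β * b) + β * a * (-b / (1 + β * b)) := by
  rw [ominus, div_eq_iff h, add_mul, add_mul, mul_assoc (β * a), div_mul_cancel₀ _ h]
  ring

theorem bpdSum_eq_finsum {β : K} (t y : ℕ → K) (hy : ∀ j, 1 + β * y j ≠ 0) {n : ℕ}
    {u : Equiv.Perm ℕ} (hu : InSn n u) :
    bpdSum β t (fun j => -y j / (1 + β * y j)) n u = ∑ᶠ π ∈ PP n n u 1 1, stateWt β n t y π := by
  classical
  have hlt (i : Fin n) : u⁻¹ i < n := inSn_lt (inSn_inv hu) i.2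
  have hrows : ((List.range n).map fun r => (-y r / (1 + β * y r), u⁻¹ r + 1)) =
      List.ofFn fun i : Fin n => (-y i / (1 + β * y i),
        ((⟨u⁻¹ i + 1, Nat.succ_lt_succ (hlt i)⟩ : Fin (n + 1)) : ℕ)) :=
    List.ext_getElem (by simp) fun j h₁ h₂ => by simp
  have htop : List.replicate n 0 = finWord fun _ : Fin n => (0 : Fin (n + 1)) := by
    simp [finWord]
  have hbot (v : Fin n → Fin (n + 1)) : finWord v = downList (fun j => j + 1) n ↔
      ∀ j, (v j : ℕ) = j + 1 := by
    refine ⟨fun h j => ?_, fun h => finWord_eq_downList v _ h⟩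
    rw [← finWord_eq_downList (fun j : Fin n => j.succ) _ fun j => Fin.val_succ j] at h
    rw [finWord_injective h, Fin.val_succ]
  rw [bpdSum, hrows, htop, gridSum_eq_sum β le_rfl, finsum_PP_eq_sum, Fintype.sum_prod_type,
    Finset.sum_comm]
  refine Finset.sum_congr rfl fun V _ => ?_
  rw [Finset.prod_univ_sum, Fintype.piFinset_univ]
  simp only [prod_ite_eq, wordDelta, hbot, Finset.sum_mul]
  have hbc (H : Fin n → Fin (n + 1) → Fin (n + 1)) : BoundaryCond n n u 1 1 (H, V) ↔
      (V 0 = fun _ => 0) ∧ (∀ i, (H i 0 : ℕ) = 0 ∧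
        H i (Fin.last n) = ⟨u⁻¹ i + 1, Nat.succ_lt_succ (hlt i)⟩) ∧
        ∀ j, (V (Fin.last n) j : ℕ) = j + 1 := by
    simp only [BoundaryCond, kappaLab, thetaLab, etaLab, hlt, if_true, inv_one,
      Equiv.Perm.one_apply, Nat.not_le.2 (Fin.is_lt _), if_false, forall_and,
      funext_iff, Fin.ext_iff, Fin.val_zero]
    tauto
  have hwt (H : Fin n → Fin (n + 1) → Fin (n + 1)) : stateWt β n t y (H, V) =
      ∏ i : Fin n, rowWt β (-y i / (1 + β * y i)) n t (V i.castSucc) (V i.succ) (H i) :=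
    Finset.prod_congr rfl fun i _ => Finset.prod_congr rfl fun j _ => by
      rw [ominus_eq (hy i)]
      rfl
  by_cases h0 : V 0 = fun _ => 0
  · rw [if_pos h0]
    refine Finset.sum_congr rfl fun H _ => ?_
    simp only [hbc, hwt, h0, true_and, mul_ite, mul_one, mul_zero, ite_and]
    split_ifs <;> rfl
  · simp [hbc, h0]

end States
theorem reflectState_injective (n : ℕ) : Function.Injective (reflectState n) := fun a b h => by
  have h1 := congrArg Prod.fst h
  have h2 := congrArg Prod.snd h
  exact Prod.ext (funext fun i => funext fun j => congrFun (congrFun h2 j) i)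
    (funext fun i => funext fun j => congrFun (congrFun h1 j) i)

/-- the bumpless pipe dream formula (Weigandt's model
recovered).  Take `k = n`, so that every `u ∈ S_n` has separated descents at `n`
with `v = id`.  Then `𝔊_u(t, y) = Σ_{π ∈ PP(u, id, id)} wt(π)`; moreover,
reflecting pipe puzzles across the main diagonal identifies `PP(u, id, id)`
bijectively with the set of bumpless pipe dreams of `u` (defined as the set of
reflected pipe puzzles). -/
theorem grothendieck_as_bumpless_pipe_dreams
    {K : Type*} [Field K] (β : K)
    (G : (ℕ → K) → Equiv.Perm ℕ → MvPolynomial ℕ K)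
    (hG : GrothFamily β G)
    (n : ℕ) (u : Equiv.Perm ℕ) (hu : InSn n u)
    (t y : ℕ → K)
    (ht : ∀ j, 1 + β * t j ≠ 0) (hy : ∀ j, 1 + β * y j ≠ 0) :
    MvPolynomial.eval t (G y u) = (∑ᶠ π ∈ PP n n u 1 1, stateWt β n t y π) ∧
    Set.BijOn (reflectState n) (PP n n u 1 1) (reflectState n '' PP n n u 1 1) := by
  refine ⟨?_, (reflectState_injective n).injOn.bijOn_image⟩
  rw [grothendieck_eq_bpdSum hG hy u hu, map_bpdSum, ← bpdSum_eq_finsum t y hy hu]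
  simp only [eval_C, eval_X]
end BPDPuzzle
end
end
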